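/- arXiv:2007.05744 — 2 statements merged into one kernel-verified Lean document; each statement's English description precedes it below -/
import Mathlib

section
/- If cd(Q, M) ≤ 1, then M has maximal depth with respect to Q. -/
open CategoryTheory MvPolynomial

noncomputable section

/-- The standard bigraded polynomial ring `S = K[x_1,…,x_m, y_1,…,y_n]`. -/
abbrev BGS (K : Type) [Field K] (m n : ℕ) : Type := MvPolynomial (Fin m ⊕ Fin n) K

/-- The bigrading weights: `deg x_i = (1,0)`, `deg y_j = (0,1)`. -/
def bwt (m n : ℕ) : Fin m ⊕ Fin n → ℕ × ℕ := Sum.elim (fun _ => (1, 0)) (fun _ => (0, 1))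

/-- `P = (x_1, …, x_m)`. -/
def idealP (K : Type) [Field K] (m n : ℕ) : Ideal (BGS K m n) :=
  Ideal.span (Set.range fun i : Fin m => (X (Sum.inl i) : BGS K m n))

/-- `Q = (y_1, …, y_n)`. -/
def idealQ (K : Type) [Field K] (m n : ℕ) : Ideal (BGS K m n) :=
  Ideal.span (Set.range fun j : Fin n => (X (Sum.inr j) : BGS K m n))

/-- `cd(J, M)`: the cohomological dimension, i.e. the largest `i` such that the local
cohomology module `H^i_J(M)` is nonzero. -/
def cohDim (R : Type) [CommRing R] (J : Ideal R) (M : Type) [AddCommGroup M] [Module R M] : ℕ :=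
  sSup {i : ℕ | Nontrivial ((localCohomology J i).obj (ModuleCat.of R M))}

/-- `grade(J, M)`: the least `i` with `Ext^i(R/J, M) ≠ 0`. -/
def extGrade (R : Type) [CommRing R] (J : Ideal R) (M : Type) [AddCommGroup M] [Module R M] : ℕ :=
  sInf {i : ℕ | Nontrivial
    (((Ext R (ModuleCat R) i).obj (Opposite.op (ModuleCat.of R (R ⧸ J)))).obj (ModuleCat.of R M))}

/-- `mgrade(J, M) = min {cd(J, R/p) : p ∈ Ass(M)}`. -/
def mCohDim (R : Type) [CommRing R] (J : Ideal R) (M : Type) [AddCommGroup M] [Module R M] : ℕ :=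
  sInf ((fun p => cohDim R J (R ⧸ p)) '' associatedPrimes R M)

/-- `M` has maximal depth with respect to `J` if `grade(J, M) = mgrade(J, M)`. -/
def HasMaximalDepth (R : Type) [CommRing R] (J : Ideal R) (M : Type) [AddCommGroup M]
    [Module R M] : Prop :=
  extGrade R J M = mCohDim R J M

/-- A bigrading on an `S`-module `M`: an internal direct sum decomposition indexed by `ℕ × ℕ`
compatible with the bigrading of `S`. -/
structure IsBigrading (K : Type) [Field K] (m n : ℕ) (M : Type) [AddCommGroup M]
    [Module (BGS K m n) M] (ℳ : ℕ × ℕ → AddSubgroup M) : Prop where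
  internal : DirectSum.IsInternal ℳ
  smul_mem : ∀ (d e : ℕ × ℕ) (s : BGS K m n) (x : M),
    IsWeightedHomogeneous (bwt m n) s d → x ∈ ℳ e → s • x ∈ ℳ (d + e)

/-- A submodule is bigraded if it is generated by bihomogeneous elements. -/
def IsBigradedSubmodule (K : Type) [Field K] (m n : ℕ) {M : Type} [AddCommGroup M]
    [Module (BGS K m n) M] (ℳ : ℕ × ℕ → AddSubgroup M) (N : Submodule (BGS K m n) M) : Prop :=
  N = Submodule.span (BGS K m n) {x : M | x ∈ N ∧ ∃ d, x ∈ ℳ d}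

namespace LC
open Limits Opposite

section Cmp
variable {R : Type} [CommRing R]

lemma homologyι_unop_surj (K : ChainComplex (ModuleCat.{0} R)ᵒᵖ ℕ) (n : ℕ) :
    Function.Surjective (K.homologyι n).unop := by
  rw [← ModuleCat.epi_iff_surjective]; infer_instance

lemma pOpcycles_unop_inj (K : ChainComplex (ModuleCat.{0} R)ᵒᵖ ℕ) (n : ℕ) :
    Function.Injective (K.pOpcycles n).unop := by
  rw [← ModuleCat.mono_iff_injective]; infer_instance

lemma homologyι_unop_exact (K : ChainComplex (ModuleCat.{0} R)ᵒᵖ ℕ) (n j : ℕ)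
    (h : (ComplexShape.down ℕ).next n = j) (z : (K.opcycles n).unop)
    (hz : (K.homologyι n).unop z = 0) : ∃ w : (K.X j).unop, (K.fromOpcycles n j).unop w = z := by
  have hex : (ShortComplex.mk (K.homologyι n) (K.fromOpcycles n j)
      (K.homologyι_comp_fromOpcycles n j)).Exact :=
    ShortComplex.exact_of_f_is_kernel _ (K.homologyIsKernel n j h)
  have h2 := hex.unop
  rw [ShortComplex.moduleCat_exact_iff] at h2
  exact h2 z hz

lemma pOpcycles_unop_exact (K : ChainComplex (ModuleCat.{0} R)ᵒᵖ ℕ) (n : ℕ)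
    (z : (K.X n).unop)
    (hz : (K.d (n+1) n).unop z = 0) : ∃ w : (K.opcycles n).unop, (K.pOpcycles n).unop w = z := by
  have hex : (ShortComplex.mk (K.d (n+1) n) (K.pOpcycles n) (by simp)).Exact :=
    ShortComplex.exact_of_g_is_cokernel _ (K.opcyclesIsCokernel (n+1) n (by simp))
  have h2 := hex.unop
  rw [ShortComplex.moduleCat_exact_iff] at h2
  exact h2 z hz

abbrev FF (Y : ModuleCat.{0} R) : ModuleCat.{0} R ⥤ (ModuleCat.{0} R)ᵒᵖ :=
  ((linearYoneda R (ModuleCat.{0} R)).obj Y).rightOp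

abbrev KK {X : ModuleCat.{0} R} (P : ProjectiveResolution X) (Y : ModuleCat.{0} R) :
    ChainComplex (ModuleCat.{0} R)ᵒᵖ ℕ :=
  ((FF Y).mapHomologicalComplex _).obj P.complex

/-- old Ext -/
abbrev OE (X Y : ModuleCat.{0} R) (n : ℕ) : ModuleCat.{0} R :=
  ((Ext R (ModuleCat.{0} R) n).obj (op X)).obj Y

/-- The iso of old Ext with the homology -/
def isoK {X : ModuleCat.{0} R} (P : ProjectiveResolution X) (Y : ModuleCat.{0} R) (n : ℕ) :
    ((KK P Y).homology n).unop ≅ OE X Y n :=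
  (P.isoLeftDerivedObj (FF Y) n).unop

lemma isoK_nat {X X' : ModuleCat.{0} R} (P : ProjectiveResolution X) (P' : ProjectiveResolution X')
    (g : X' ⟶ X) (φ : ProjectiveResolution.Hom P' P g) (Y : ModuleCat.{0} R) (n : ℕ) :
    (isoK P Y n).hom ≫ ((Ext R (ModuleCat.{0} R) n).map g.op).app Y =
    (HomologicalComplex.homologyMap (((FF Y).mapHomologicalComplex _).map φ.hom) n).unop ≫
      (isoK P' Y n).hom := by
  have := P'.isoLeftDerivedObj_hom_naturality g P φ.hom (by simpa using φ.hom_f_zero_comp_π_f_zero) (FF Y) n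
  exact congrArg Quiver.Hom.unop this

/-- `f` is a cocycle representing `e`. -/
def Rep {X Y : ModuleCat.{0} R} {n : ℕ} (P : ProjectiveResolution X) (e : OE X Y n)
    (f : P.complex.X n ⟶ Y) : Prop :=
  ∃ z : ((KK P Y).opcycles n).unop,
    (isoK P Y n).hom (((KK P Y).homologyι n).unop z) = e ∧ ((KK P Y).pOpcycles n).unop z = f

variable {X Y : ModuleCat.{0} R} {n : ℕ} (P : ProjectiveResolution X)

lemma rep_exists (e : OE X Y n) : ∃ f, Rep P e f := by
  obtain ⟨z, hz⟩ := homologyι_unop_surj (KK P Y) n ((isoK P Y n).inv e)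
  exact ⟨_, z, by rw [hz]; simp, rfl⟩

lemma rep_cocycle (e : OE X Y n) (f) (h : Rep P e f) : P.complex.d (n+1) n ≫ f = 0 := by
  obtain ⟨z, -, rfl⟩ := h
  have : ((KK P Y).pOpcycles n).unop ≫ ((KK P Y).d (n+1) n).unop = 0 := by
    rw [← unop_comp, HomologicalComplex.d_pOpcycles]; rfl
  exact congrArg (fun t => t.hom z) this

lemma cocycle_rep (f : P.complex.X n ⟶ Y) (h : P.complex.d (n+1) n ≫ f = 0) :
    ∃ e, Rep P e f := by
  obtain ⟨w, hw⟩ := pOpcycles_unop_exact (KK P Y) n f h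
  exact ⟨_, w, rfl, hw⟩

lemma rep_sub {e e' : OE X Y n} {f f'} (h : Rep P e f) (h' : Rep P e' f') :
    Rep P (e - e') (f - f') := by
  obtain ⟨z, rfl, rfl⟩ := h
  obtain ⟨z', rfl, rfl⟩ := h'
  refine ⟨z - z', ?_, ?_⟩
  · simp [map_sub]
  · exact map_sub ((KK P Y).pOpcycles n).unop.hom z z'

lemma rep_zero_iff {e : OE X Y n} {f} (h : Rep P e f) (j : ℕ) 
    (hj : (ComplexShape.down ℕ).next n = j) : e = 0 ↔ ∃ g, P.complex.d n j ≫ g = f := by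
  have hp : ((KK P Y).fromOpcycles n j).unop ≫ ((KK P Y).pOpcycles n).unop = 
    ((KK P Y).d n j).unop := by rw [← unop_comp]; simp
  obtain ⟨z, rfl, rfl⟩ := h
  constructor
  · intro h0
    have h1 : ((KK P Y).homologyι n).unop z = 0 := by
      have := congrArg (isoK P Y n).inv h0
      simpa using this
    obtain ⟨w, rfl⟩ := homologyι_unop_exact _ _ _ hj z h1
    exact ⟨w, (congrArg (fun t => t.hom w) hp).symm⟩
  · rintro ⟨g, hg⟩
    have h2 : ((KK P Y).fromOpcycles n j).unop g = z := by
      apply pOpcycles_unop_inj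
      rw [← hg]
      exact congrArg (fun t => t.hom g) hp
    have h3 : ((KK P Y).fromOpcycles n j).unop ≫ ((KK P Y).homologyι n).unop = 0 := by
      rw [← unop_comp]; simp
    have h4 : ((KK P Y).homologyι n).unop z = 0 := by
      rw [← h2]
      exact congrArg (fun t => t.hom g) h3
    rw [h4, map_zero]

lemma rep_nat {X' : ModuleCat.{0} R} (P' : ProjectiveResolution X')
    (g : X' ⟶ X) (φ : ProjectiveResolution.Hom P' P g) {e : OE X Y n} {f} (h : Rep P e f) :
    Rep P' (((Ext R (ModuleCat.{0} R) n).map g.op).app Y e) (φ.hom.f n ≫ f) := by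
  obtain ⟨z, rfl, rfl⟩ := h
  refine ⟨(HomologicalComplex.opcyclesMap (((FF Y).mapHomologicalComplex _).map φ.hom) n).unop z, ?_, ?_⟩
  · have h1 := isoK_nat P P' g φ Y n
    have h2 := HomologicalComplex.homologyι_naturality (((FF Y).mapHomologicalComplex _).map φ.hom) n
    have h1' := congrArg (fun t => t.hom (((KK P Y).homologyι n).unop z)) h1
    have h2' := congrArg (fun t => t.unop.hom z) h2
    dsimp at h1' h2'
    erw [h1', h2']
  · have h2 := HomologicalComplex.p_opcyclesMap (((FF Y).mapHomologicalComplex _).map φ.hom) n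
    exact congrArg (fun t => t.unop.hom z) h2

/-- New Ext. -/
abbrev NE (X Y : ModuleCat.{0} R) (n : ℕ) := Abelian.Ext.{0} X Y n

/-- Comparison map in positive degrees. -/
def cmp (X Y : ModuleCat.{0} R) (n : ℕ) (e : OE X Y (n+1)) : NE X Y (n+1) :=
  (projectiveResolution X).extMk (rep_exists (projectiveResolution X) e).choose (n+2) rfl
    (rep_cocycle _ e _ (rep_exists (projectiveResolution X) e).choose_spec)

lemma rep_extMk_zero {e : OE X Y (n+1)} {f} (h : Rep P e f) :
    P.extMk f (n+2) rfl (rep_cocycle _ e _ h) = 0 ↔ e = 0 := by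
  rw [P.extMk_eq_zero_iff f (n+2) rfl _ n rfl, rep_zero_iff P h n (by simp)]

lemma cmp_eq {e : OE X Y (n+1)} {f} (h : Rep (projectiveResolution X) e f) :
    cmp X Y n e = (projectiveResolution X).extMk f (n+2) rfl (rep_cocycle _ e _ h) := by
  have h' := (rep_exists (projectiveResolution X) e).choose_spec
  rw [← sub_eq_zero, cmp, ProjectiveResolution.sub_extMk]
  rw [rep_extMk_zero _ (rep_sub _ h' h), sub_self]

lemma cmp_zero_iff (e : OE X Y (n+1)) : cmp X Y n e = 0 ↔ e = 0 := by
  obtain ⟨f, hf⟩ := rep_exists (projectiveResolution X) e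
  rw [cmp_eq hf, rep_extMk_zero _ hf]

lemma cmp_surj (e : NE X Y (n+1)) : ∃ e', cmp X Y n e' = e := by
  obtain ⟨f, hf, rfl⟩ := (projectiveResolution X).extMk_surjective e (n+2) rfl
  obtain ⟨e', he'⟩ := cocycle_rep _ f hf
  exact ⟨e', cmp_eq he'⟩

lemma cmp_nat {X' : ModuleCat.{0} R} (g : X' ⟶ X) (e : OE X Y (n+1)) :
    cmp X' Y n (((Ext R (ModuleCat.{0} R) (n+1)).map g.op).app Y e) =
    (Abelian.Ext.mk₀ g).comp (cmp X Y n e) (zero_add _) := by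
  obtain ⟨f, hf⟩ := rep_exists (projectiveResolution X) e
  let φ : ProjectiveResolution.Hom (projectiveResolution X') (projectiveResolution X) g :=
    ⟨ProjectiveResolution.lift g _ _, by
      have := HomologicalComplex.congr_hom (ProjectiveResolution.lift_commutes g (projectiveResolution X')
        (projectiveResolution X)) 0
      exact this.trans (by simp)⟩
  rw [cmp_eq hf, ProjectiveResolution.mk₀_comp_extMk _ _ _ _ φ, cmp_eq (rep_nat _ _ g φ hf)]

lemma nontrivial_OE_succ : Nontrivial (OE X Y (n+1)) ↔ ∃ e : NE X Y (n+1), e ≠ 0 := by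
  rw [nontrivial_iff_exists_ne 0]
  constructor
  · rintro ⟨e, he⟩
    exact ⟨cmp X Y n e, by rwa [Ne, cmp_zero_iff]⟩
  · rintro ⟨e, he⟩
    obtain ⟨e', rfl⟩ := cmp_surj e
    exact ⟨e', by rwa [Ne, cmp_zero_iff] at he⟩

lemma nontrivial_OE_zero : Nontrivial (OE X Y 0) ↔ ∃ f : X ⟶ Y, f ≠ 0 := by
  rw [nontrivial_iff_exists_ne 0]
  let P := projectiveResolution X
  have hd : P.complex.d 0 0 = 0 := P.complex.shape _ _ (by simp)
  constructor
  · rintro ⟨e, he⟩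
    obtain ⟨f, hf⟩ := rep_exists P e
    have h0 := rep_cocycle _ _ _ hf
    rw [Ne, rep_zero_iff P hf 0 (by simp)] at he
    have : Epi (ShortComplex.mk (P.complex.d 1 0) (P.π.f 0) P.complex_d_comp_π_f_zero).g :=
      inferInstanceAs (Epi (P.π.f 0))
    refine ⟨P.exact₀.desc f h0, fun h2 => he ⟨0, ?_⟩⟩
    rw [hd, zero_comp]
    have h3 := P.exact₀.g_desc f h0
    rw [← h3]
    erw [h2]
    exact comp_zero.symm
  · rintro ⟨f, hf⟩
    obtain ⟨e, he⟩ := cocycle_rep P (P.π.f 0 ≫ f) 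
      ((P.complex_d_comp_π_f_zero_assoc f).trans zero_comp)
    refine ⟨e, ?_⟩
    rw [Ne, rep_zero_iff P he 0 (by simp), hd]
    rintro ⟨g, hg⟩
    apply hf
    rw [zero_comp] at hg
    exact (cancel_epi (P.π.f 0)).1 (hg.symm.trans comp_zero.symm)

end Cmp

section Colim
variable {R : Type} [CommRing R] (J : Ideal R)

/-- transition maps -/
def tr {k l : ℕ} (h : k ≤ l) : ModuleCat.of R (R ⧸ J ^ l) ⟶ ModuleCat.of R (R ⧸ J ^ k) :=
  ModuleCat.ofHom <| Submodule.mapQ _ _ LinearMap.id (Ideal.pow_le_pow_right h)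

/-- Vanishing of local cohomology, elementwise. -/
def V (i : ℕ) (N : ModuleCat.{0} R) : Prop :=
  ∀ (k : ℕ) (e : NE (ModuleCat.of R (R ⧸ J ^ k)) N i), ∃ (l : ℕ) (h : k ≤ l),
    (Abelian.Ext.mk₀ (tr J h)).comp e (zero_add _) = 0

lemma nontrivial_lc (i : ℕ) (N : ModuleCat.{0} R) :
    Nontrivial ((localCohomology J (i+1)).obj N) ↔ ¬ V J (i+1) N := by
  let D := localCohomology.diagram (localCohomology.idealPowersDiagram J) (i+1)
  have hc : IsColimit (((evaluation _ _).obj N).mapCocone (colimit.cocone D)) := 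
    isColimitOfPreserves _ (colimit.isColimit D)
  let F : ℕᵒᵖᵒᵖ ⥤ ModuleCat R := D ⋙ (evaluation _ _).obj N
  have hD : ∀ (k l : ℕ) (h : k ≤ l), F.map (homOfLE h).op.op = 
    ((Ext R (ModuleCat.{0} R) (i+1)).map (tr J h).op).app N := fun _ _ _ => rfl
  rw [← not_iff_not, not_not, not_nontrivial_iff_subsingleton]
  constructor
  · intro hs k e
    obtain ⟨e', rfl⟩ := cmp_surj e
    obtain ⟨l, f, g, hf⟩ := Concrete.isColimit_exists_of_rep_eq F 
      (i := op (op k)) (j := op (op k)) hc e' 0 (@Subsingleton.elim _ hs _ _)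
    rw [map_zero] at hf
    have h := leOfHom f.unop.unop
    refine ⟨l.unop.unop, h, ?_⟩
    rw [← cmp_nat, cmp_zero_iff]
    exact hf
  · intro hV
    suffices ∀ a : ToType ((((evaluation _ _).obj N).mapCocone (colimit.cocone D)).pt), a = 0 from
      ⟨fun a b => (this a).trans (this b).symm⟩
    intro a
    obtain ⟨k, e, rfl⟩ := Concrete.isColimit_exists_rep F hc a
    obtain ⟨l, h, hl⟩ := hV k.unop.unop (cmp _ _ _ (show OE _ N (i+1) from e))
    replace hl := (cmp_zero_iff _).1 ((cmp_nat _ _).trans hl)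
    have := Concrete.isColimit_rep_eq_of_exists F (D := ((evaluation _ _).obj N).mapCocone (colimit.cocone D))
       (i := k) (j := k) e 0 ⟨op (op l), (homOfLE h).op.op, (homOfLE h).op.op, by
        rw [map_zero]; exact hl⟩
    rw [this, map_zero]

end Colim
end LC

namespace LC
open Limits Opposite Abelian

section Ses
variable {R : Type} [CommRing R] (J : Ideal R)

/-- restriction along a map in the first variable -/
def rs {X' X N : ModuleCat.{0} R} {i : ℕ} (f : X' ⟶ X) (e : NE X N i) : NE X' N i :=
  (Ext.mk₀ f).comp e (zero_add _)

/-- pushing forward along a map in the second variable -/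
def po {X N N' : ModuleCat.{0} R} {i : ℕ} (e : NE X N i) (g : N ⟶ N') : NE X N' i :=
  e.comp (Ext.mk₀ g) (add_zero _)

section
variable {X'' X' X N N' : ModuleCat.{0} R} {i : ℕ}

lemma rs_rs (f : X'' ⟶ X') (g : X' ⟶ X) (e : NE X N i) : rs f (rs g e) = rs (f ≫ g) e := 
  Ext.mk₀_comp_mk₀_assoc _ _ _

lemma rs_po (f : X' ⟶ X) (e : NE X N i) (g : N ⟶ N') : rs f (po e g) = po (rs f e) g := by
  unfold rs po
  rw [Ext.comp_assoc_of_third_deg_zero]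

lemma rs_id (e : NE X N i) : rs (𝟙 X) e = e := Ext.mk₀_id_comp _

lemma po_id (e : NE X N i) : po e (𝟙 N) = e := Ext.comp_mk₀_id _

@[simp] lemma rs_zero (f : X' ⟶ X) : rs f (0 : NE X N i) = 0 := by simp [rs]
@[simp] lemma po_zero (g : N ⟶ N') : po (0 : NE X N i) g = 0 := by simp [po]
@[simp] lemma zero_rs (e : NE X N i) : rs (0 : X' ⟶ X) e = 0 := by simp [rs]
@[simp] lemma zero_po (e : NE X N i) : po e (0 : N ⟶ N') = 0 := by simp [po]
end

lemma tr_tr {k l m : ℕ} (h : k ≤ l) (h' : l ≤ m) : tr J h' ≫ tr J h = tr J (h.trans h') := by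
  ext; rfl

lemma V_def {i : ℕ} {N : ModuleCat.{0} R} : V J i N ↔ 
  ∀ (k : ℕ) (e : NE (ModuleCat.of R (R ⧸ J ^ k)) N i), ∃ (l : ℕ) (h : k ≤ l),
    rs (tr J h) e = 0 := Iff.rfl

variable {A B C : Type} [AddCommGroup A] [AddCommGroup B] [AddCommGroup C]
  [Module R A] [Module R B] [Module R C] {f : A →ₗ[R] B} {g : B →ₗ[R] C}

/-- The short complex associated to maps. -/
abbrev sc (f : A →ₗ[R] B) (g : B →ₗ[R] C) (h : Function.Exact f g) : ShortComplex (ModuleCat.{0} R) :=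
  ShortComplex.mk (ModuleCat.ofHom f) (ModuleCat.ofHom g) (by
    ext x; exact h.apply_apply_eq_zero x)

lemma sc_exact (hf : Function.Injective f) (hg : Function.Surjective g) (h : Function.Exact f g) :
    (sc f g h).ShortExact where
  exact := (ShortComplex.ShortExact.moduleCat_exact_iff_function_exact _).2 h
  mono_f := (ModuleCat.mono_iff_injective _).2 hf
  epi_g := (ModuleCat.epi_iff_surjective _).2 hg

lemma V_mid (hf : Function.Injective f) (hg : Function.Surjective g) (h : Function.Exact f g) {i : ℕ}
    (hA : V J i (ModuleCat.of R A)) (hC : V J i (ModuleCat.of R C)) : V J i (ModuleCat.of R B) := by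
  rw [V_def] at *
  intro k e
  have hS := sc_exact hf hg h
  obtain ⟨l, hl, h1⟩ := hC k (po e (sc f g h).g)
  rw [rs_po] at h1
  obtain ⟨a, ha⟩ := Ext.covariant_sequence_exact₂ _ hS (rs (tr J hl) e) h1
  obtain ⟨l', hl', h2⟩ := hA l a
  refine ⟨l', hl.trans hl', ?_⟩
  rw [← tr_tr J hl hl', ← rs_rs, ← ha]
  change rs _ (po a _) = 0
  rw [rs_po, h2, po_zero]

lemma V_right (hf : Function.Injective f) (hg : Function.Surjective g) (h : Function.Exact f g) {i : ℕ}
    (hA : V J (i+1) (ModuleCat.of R A)) (hB : V J i (ModuleCat.of R B)) : V J i (ModuleCat.of R C) := by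
  rw [V_def] at *
  intro k e
  have hS := sc_exact hf hg h
  obtain ⟨l, hl, h1⟩ := hA k (e.comp hS.extClass rfl)
  have h1' : (rs (tr J hl) e).comp hS.extClass rfl = 0 := by
    rw [← h1]; unfold rs
    exact Ext.comp_assoc _ _ _ _ _ (by omega)
  obtain ⟨a, ha⟩ := Ext.covariant_sequence_exact₃ _ hS (rs (tr J hl) e) rfl h1'
  obtain ⟨l', hl', h2⟩ := hB l a
  refine ⟨l', hl.trans hl', ?_⟩
  rw [← tr_tr J hl hl', ← rs_rs, ← ha]
  change rs _ (po a _) = 0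
  rw [rs_po, h2, po_zero]

lemma V_zero [Subsingleton A] (i : ℕ) : V J i (ModuleCat.of R A) := by
  intro k e
  refine ⟨k, le_rfl, ?_⟩
  have : 𝟙 (ModuleCat.of R A) = 0 := by ext x; exact Subsingleton.elim _ _
  rw [← po_id e, this, zero_po]
  exact rs_zero _

lemma V_equiv (e : A ≃ₗ[R] B) {i : ℕ} (hB : V J i (ModuleCat.of R B)) : V J i (ModuleCat.of R A) := by
  refine V_mid J (f := (0 : PUnit →ₗ[R] A)) (g := e.toLinearMap) (fun _ _ _ => rfl) e.surjective ?_
    (V_zero J i) hB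
  intro x
  simpa using eq_comm

end Ses
end LC

namespace LC
open TensorProduct

lemma exists_functional {R : Type} [CommRing R] (M : Type) [AddCommGroup M] [Module R M] 
    [Module.Finite R M] (p : Ideal R) [hp : p.IsPrime] (h : Module.annihilator R M ≤ p) :
    ∃ φ : M →ₗ[R] R ⧸ p, φ ≠ 0 := by
  have h1 : (⟨p, hp⟩ : PrimeSpectrum R) ∈ Module.support R M := Module.mem_support_iff_of_finite.2 h
  rw [Module.mem_support_iff_nontrivial_residueField_tensorProduct] at h1
  change Nontrivial (p.ResidueField ⊗[R] M) at h1
  obtain ⟨v, hv⟩ := exists_ne (0 : p.ResidueField ⊗[R] M)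
  obtain ⟨F, hF⟩ : ∃ F : Module.Dual p.ResidueField (p.ResidueField ⊗[R] M), F v ≠ 0 := by
    by_contra! hcon
    exact hv ((Module.forall_dual_apply_eq_zero_iff _ v).1 hcon)
  let ψ : M →ₗ[R] p.ResidueField := (F.restrictScalars R) ∘ₗ (TensorProduct.mk R p.ResidueField M 1)
  obtain ⟨x, hx⟩ : ∃ x, ψ x ≠ 0 := by
    by_contra! hcon
    apply hF
    clear hF hv
    induction v using TensorProduct.induction_on with
    | zero => simp
    | add a b ha hb => 
      rw [map_add, ha, hb, add_zero]
    | tmul a m => 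
      have : a ⊗ₜ[R] m = a • ((1 : p.ResidueField) ⊗ₜ[R] m) := by simp [TensorProduct.smul_tmul']
      rw [this, map_smul]
      have := hcon m
      simp [ψ] at this
      simp [this]
  obtain ⟨s, hs⟩ := Module.Finite.fg_top (R := R) (M := M)
  obtain ⟨b, hb⟩ := IsLocalization.exist_integer_multiples (nonZeroDivisors (R ⧸ p)) s (fun m => ψ m) 
  let L : R ⧸ p →ₗ[R] p.ResidueField := (Algebra.linearMap (R ⧸ p) p.ResidueField).restrictScalars R
  have hLi : Function.Injective L := IsFractionRing.injective (R ⧸ p) p.ResidueField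
  obtain ⟨β, hβ⟩ := Ideal.Quotient.mk_surjective b.1
  have hr : ∀ m, (β • ψ) m ∈ LinearMap.range L := by
    have : (⊤ : Submodule R M) ≤ (LinearMap.range L).comap (β • ψ) := by
      rw [← hs, Submodule.span_le]
      intro m hm
      obtain ⟨t, ht⟩ := hb m hm
      refine ⟨t, ht.trans ?_⟩
      rw [← hβ]
      exact algebraMap_smul (R ⧸ p) β (ψ m)
    exact fun m => this trivial
  let φ : M →ₗ[R] R ⧸ p := (LinearEquiv.ofInjective L hLi).symm.toLinearMap ∘ₗ 
    LinearMap.codRestrict _ (β • ψ) hr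
  refine ⟨φ, fun h0 => ?_⟩
  have h2 : φ x = 0 := by rw [h0]; rfl
  have h3 : (β • ψ) x = 0 := by
    have h4 : LinearMap.codRestrict _ (β • ψ) hr x = 0 := by
      simpa [φ, -LinearMap.smul_apply] using h2
    exact congrArg Subtype.val h4
  have h5 : (b : R ⧸ p) • ψ x = 0 := by
    rw [← hβ]
    exact (algebraMap_smul (R ⧸ p) β (ψ x)).trans h3
  rw [Algebra.smul_def, mul_eq_zero] at h5
  refine h5.elim (fun h6 => ?_) hx
  exact nonZeroDivisors.coe_ne_zero b (hLi (h6.trans (map_zero L).symm))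

lemma support_thm {R : Type} [CommRing R] [IsNoetherianRing R] (J : Ideal R) (n c : ℕ)
    (hb : ∀ i > n, ∀ (N : Type) [AddCommGroup N] [Module R N] [Module.Finite R N],
      V J i (ModuleCat.of R N))
    (M : Type) [AddCommGroup M] [Module R M] [Module.Finite R M]
    (hM : ∀ i ≥ c, V J i (ModuleCat.of R M)) (i : ℕ) (hi : c ≤ i)
    (N : Type) [AddCommGroup N] [Module R N] [Module.Finite R N]
    (hN : Module.annihilator R M ≤ Module.annihilator R N) : V J i (ModuleCat.of R N) := by
  suffices H : ∀ d i, c ≤ i → n < i + d → 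
      ∀ (N : Type) [AddCommGroup N] [Module R N] [Module.Finite R N],
        Module.annihilator R M ≤ Module.annihilator R N → V J i (ModuleCat.of R N) from
    H (n+1) i hi (by omega) N hN
  clear hN hi i
  intro d
  induction d with
  | zero => intro i _ h N _ _ _ _; exact hb i h N
  | succ d ihd =>
    intro i hi hid
    have ih1 := ihd (i+1) (by omega) (by omega)
    suffices H : ∀ I : Ideal R, Module.annihilator R M ≤ I → 
        ∀ (N : Type) [AddCommGroup N] [Module R N] [Module.Finite R N],
          I ≤ Module.annihilator R N → V J i (ModuleCat.of R N) from
      fun N _ _ _ h => H _ le_rfl N h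
    intro I
    induction I using WellFoundedGT.induction with
    | _ I ih =>
    intro hI N _ _ hfin
    refine IsNoetherianRing.induction_on_isQuotientEquivQuotientPrime R hfin 
      (motive := fun N _ _ _ => I ≤ Module.annihilator R N → V J i (ModuleCat.of R N)) ?_ ?_ ?_
    · intro N _ _ _ _ _; exact V_zero J i
    · intro N _ _ _ p e hIN
      rw [e.annihilator_eq, Ideal.annihilator_quotient] at hIN
      rcases lt_or_eq_of_le hIN with hlt | heq
      · refine ih _ hlt (hI.trans hIN) N ?_
        rw [e.annihilator_eq, Ideal.annihilator_quotient]
      · refine V_equiv J e ?_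
        have hp := p.isPrime
        obtain ⟨φ, hφ⟩ := exists_functional M p.asIdeal (hI.trans hIN)
        have hr : V J i (ModuleCat.of R (LinearMap.range φ)) := by
          refine V_right J (f := (LinearMap.ker φ).subtype) (g := φ.rangeRestrict) 
            Subtype.val_injective φ.surjective_rangeRestrict ?_ (ih1 _ ?_) (hM i hi)
          · intro x
            simp [Subtype.ext_iff]
          · exact LinearMap.annihilator_le_of_injective (LinearMap.ker φ).subtype 
              Subtype.val_injective
        have hq : V J i (ModuleCat.of R ((R ⧸ p.asIdeal) ⧸ LinearMap.range φ)) := by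
          have hle : p.asIdeal ≤ Module.annihilator R ((R ⧸ p.asIdeal) ⧸ LinearMap.range φ) := by
            conv_lhs => rw [← Ideal.annihilator_quotient (I := p.asIdeal)]
            exact LinearMap.annihilator_le_of_surjective (LinearMap.range φ).mkQ 
              (Submodule.mkQ_surjective _)
          refine ih _ ?_ (hI.trans (hIN.trans hle)) _ le_rfl
          rw [heq]
          refine lt_of_le_not_ge hle fun hge => hφ ?_
          ext x
          obtain ⟨r, hr⟩ := Ideal.Quotient.mk_surjective (φ x)
          have hr' : r ∈ Module.annihilator R ((R ⧸ p.asIdeal) ⧸ LinearMap.range φ) := by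
            rw [Module.mem_annihilator]
            intro y
            obtain ⟨y, rfl⟩ := Submodule.mkQ_surjective _ y
            obtain ⟨y, rfl⟩ := Ideal.Quotient.mk_surjective y
            rw [← map_smul, Submodule.mkQ_apply, Submodule.Quotient.mk_eq_zero]
            refine ⟨y • x, ?_⟩
            rw [map_smul, ← hr]
            change Ideal.Quotient.mk _ (y * r) = Ideal.Quotient.mk _ (r * y)
            rw [mul_comm]
          have := hge hr'
          rw [← hr, LinearMap.zero_apply, Ideal.Quotient.eq_zero_iff_mem]
          exact this
        refine V_mid J (f := (LinearMap.range φ).subtype) (g := (LinearMap.range φ).mkQ) 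
          Subtype.val_injective (Submodule.mkQ_surjective _) ?_ hr hq
        intro x
        simp
    · intro N₁ _ _ _ N₂ _ _ _ N₃ _ _ _ f g hf hg hfg h1 h3 h
      exact V_mid J hf hg hfg (h1 (h.trans (LinearMap.annihilator_le_of_injective f hf)))
        (h3 (h.trans (LinearMap.annihilator_le_of_surjective g hg)))

end LC

namespace LC
open Limits Opposite Abelian

section Torsion
variable {R : Type} [CommRing R] (J : Ideal R) 

lemma rs_mk₀ {X' X N : ModuleCat.{0} R} (f : X' ⟶ X) (g : X ⟶ N) :
    rs f (Ext.mk₀ g) = Ext.mk₀ (f ≫ g) := Ext.mk₀_comp_mk₀ _ _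

lemma mk₀_zero_iff {X N : ModuleCat.{0} R} (g : X ⟶ N) : Ext.mk₀ g = 0 ↔ g = 0 := by
  rw [← Ext.mk₀_zero]
  exact (Ext.mk₀_bijective X N).1.eq_iff

lemma not_V_zero {N : Type} [AddCommGroup N] [Module R N] [Nontrivial N]
    (h : J ≤ Module.annihilator R N) : ¬ V J 0 (ModuleCat.of R N) := by
  intro hV
  obtain ⟨x, hx⟩ := exists_ne (0 : N)
  let φ : R ⧸ J ^ 1 →ₗ[R] N := Submodule.liftQ _ (LinearMap.toSpanSingleton R N x) (by
    intro r hr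
    rw [pow_one] at hr
    rw [LinearMap.mem_ker, LinearMap.toSpanSingleton_apply]
    exact Module.mem_annihilator.1 (h hr) x)
  obtain ⟨l, hl, h0⟩ := hV 1 (Ext.mk₀ (ModuleCat.ofHom φ))
  change rs _ _ = 0 at h0
  rw [rs_mk₀, mk₀_zero_iff] at h0
  have h1 := congrArg (fun t => t.hom (Submodule.Quotient.mk 1)) h0
  apply hx
  have h2 : (1 : R) • x = 0 := h1
  rwa [one_smul] at h2

lemma tf_pow {N : Type} [AddCommGroup N] [Module R N]
    (h : ∀ x : N, (∀ a ∈ J, a • x = 0) → x = 0) (k : ℕ) (x : N)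
    (hx : ∀ a ∈ J ^ k, a • x = 0) : x = 0 := by
  induction k generalizing x with
  | zero => simpa using hx 1 (by simp)
  | succ k ih =>
    refine ih x fun a ha => h _ fun b hb => ?_
    rw [← mul_smul]
    exact hx _ (by rw [pow_succ']; exact Ideal.mul_mem_mul hb ha)

/-- maps from modules killed by powers of `J`. -/
lemma hom_zero_of_tf {N : Type} [AddCommGroup N] [Module R N]
    (h : ∀ x : N, (∀ a ∈ J, a • x = 0) → x = 0) (k : ℕ) 
    {T : ModuleCat.{0} R} (hT : J ^ k ≤ Module.annihilator R T) (e : NE T (ModuleCat.of R N) 0) :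
    e = 0 := by
  obtain ⟨f, rfl⟩ := (Ext.mk₀_bijective _ _).2 e
  rw [mk₀_zero_iff]
  ext t
  refine tf_pow J h k _ fun a ha => ?_
  rw [← map_smul, Module.mem_annihilator.1 (hT ha) t, map_zero]

lemma ann_pow (k : ℕ) : J ^ k ≤ Module.annihilator R (ModuleCat.of R (R ⧸ J ^ k)) := by
  change J ^ k ≤ Module.annihilator R (R ⧸ J ^ k)
  rw [Ideal.annihilator_quotient]

lemma V_zero_of_tf {N : Type} [AddCommGroup N] [Module R N]
    (h : ∀ x : N, (∀ a ∈ J, a • x = 0) → x = 0) : V J 0 (ModuleCat.of R N) := by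
  intro k e
  refine ⟨k, le_rfl, ?_⟩
  rw [hom_zero_of_tf J h k (ann_pow J k) e]
  exact rs_zero _

lemma ext_one_zero [IsNoetherianRing R] {N : Type} [AddCommGroup N] [Module R N]
    (h : ∀ x : N, (∀ a ∈ J, a • x = 0) → x = 0) 
    (h1 : ∀ e : NE (ModuleCat.of R (R ⧸ J)) (ModuleCat.of R N) 1, e = 0) (k : ℕ)
    {T : Type} [AddCommGroup T] [Module R T] [hT : Module.Finite R T] 
    (hJ : J ^ k ≤ Module.annihilator R T) (e : NE (ModuleCat.of R T) (ModuleCat.of R N) 1) :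
    e = 0 := by
  refine IsNoetherianRing.induction_on_isQuotientEquivQuotientPrime R hT
      (motive := fun T _ _ _ => J ^ k ≤ Module.annihilator R T → 
        ∀ e : NE (ModuleCat.of R T) (ModuleCat.of R N) 1, e = 0) ?_ ?_ ?_ hJ e
  · intro T _ _ _ _ _ e
    have : 𝟙 (ModuleCat.of R T) = 0 := by ext x; exact Subsingleton.elim _ _
    rw [← rs_id e, this, zero_rs]
  · intro T _ _ _ p eq hJT e
    rw [eq.annihilator_eq, Ideal.annihilator_quotient] at hJT
    have hJp := Ideal.IsPrime.le_of_pow_le (hP := p.isPrime) hJT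
    let g : R ⧸ J →ₗ[R] T := eq.symm.toLinearMap ∘ₗ Submodule.mapQ J p.asIdeal LinearMap.id hJp
    have hg : Function.Surjective g := by
      refine eq.symm.surjective.comp ?_
      intro y
      obtain ⟨y, rfl⟩ := Submodule.mkQ_surjective _ y
      exact ⟨Submodule.mkQ _ y, rfl⟩
    have hex : Function.Exact (LinearMap.ker g).subtype g := fun x => by simp
    have hS := sc_exact Subtype.val_injective hg hex
    obtain ⟨b, rfl⟩ := Ext.contravariant_sequence_exact₃ hS _ e (h1 _) (add_zero 1)
    have hb : b = 0 := by
      refine hom_zero_of_tf J h 1 ?_ b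
      rw [pow_one]
      refine le_trans ?_ (LinearMap.annihilator_le_of_injective (LinearMap.ker g).subtype 
        Subtype.val_injective)
      rw [Ideal.annihilator_quotient]
    rw [hb, Ext.comp_zero]
  · intro N₁ _ _ _ N₂ _ _ _ N₃ _ _ _ f g hf hg hfg h1 h3 h e
    obtain ⟨b, rfl⟩ := Ext.contravariant_sequence_exact₂ (sc_exact hf hg hfg) _ e
      (h1 (h.trans (LinearMap.annihilator_le_of_injective f hf)) _)
    rw [h3 (h.trans (LinearMap.annihilator_le_of_surjective g hg)) b]
    exact rs_zero _

lemma V_one_of [IsNoetherianRing R] {N : Type} [AddCommGroup N] [Module R N]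
    (h : ∀ x : N, (∀ a ∈ J, a • x = 0) → x = 0)
    (h1 : ∀ e : NE (ModuleCat.of R (R ⧸ J)) (ModuleCat.of R N) 1, e = 0) :
    V J 1 (ModuleCat.of R N) := by
  intro k e
  refine ⟨k, le_rfl, ?_⟩
  rw [ext_one_zero J h h1 k (ann_pow J k) e]
  exact rs_zero _

lemma rs_extClass {S₁ S₂ : ShortComplex (ModuleCat.{0} R)} (h₁ : S₁.ShortExact) (h₂ : S₂.ShortExact)
    (φ : S₁ ⟶ S₂) {N : ModuleCat.{0} R} {i j : ℕ} (b : NE S₂.X₁ N i) (h : 1 + i = j) :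
    rs φ.τ₃ (h₂.extClass.comp b h) = h₁.extClass.comp (rs φ.τ₁ b) h := by
  unfold rs
  rw [← Ext.comp_assoc_of_second_deg_zero, ShortComplex.ShortExact.extClass_naturality h₁ h₂ φ]
  exact (Ext.comp_assoc _ _ _ (zero_add 1) h (by omega)).symm

lemma rs_extClass_zero {A₁ B₁ C₁ A₂ B₂ C₂ : Type} [AddCommGroup A₁] [AddCommGroup B₁] [AddCommGroup C₁]
    [AddCommGroup A₂] [AddCommGroup B₂] [AddCommGroup C₂] [Module R A₁] [Module R B₁] [Module R C₁]
    [Module R A₂] [Module R B₂] [Module R C₂] (f₁ : A₁ →ₗ[R] B₁) (g₁ : B₁ →ₗ[R] C₁)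
    (f₂ : A₂ →ₗ[R] B₂) (g₂ : B₂ →ₗ[R] C₂) (hf₁ : Function.Injective f₁) (hg₁ : Function.Surjective g₁)
    (h₁ : Function.Exact f₁ g₁) (h₂ : Function.Exact f₂ g₂) (hS : (sc f₂ g₂ h₂).ShortExact)
    (τ₁ : A₁ →ₗ[R] A₂) (τ₂ : B₁ →ₗ[R] B₂) (τ₃ : C₁ →ₗ[R] C₂)
    (c₁ : ∀ x, f₂ (τ₁ x) = τ₂ (f₁ x)) (c₂ : ∀ x, g₂ (τ₂ x) = τ₃ (g₁ x)) (W : Submodule R A₂)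
    (hτ : ∀ x, τ₁ x ∈ W) {N : ModuleCat.{0} R} {i j : ℕ} (b : NE (ModuleCat.of R A₂) N i) (h : 1 + i = j)
    (hb : rs (ModuleCat.ofHom W.subtype) b = 0) :
    rs (ModuleCat.ofHom τ₃) (hS.extClass.comp b h) = 0 := by
  have hS₁ := sc_exact hf₁ hg₁ h₁
  let φ : sc f₁ g₁ h₁ ⟶ sc f₂ g₂ h₂ :=
    { τ₁ := ModuleCat.ofHom τ₁
      τ₂ := ModuleCat.ofHom τ₂
      τ₃ := ModuleCat.ofHom τ₃
      comm₁₂ := by ext x; exact c₁ x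
      comm₂₃ := by ext x; exact c₂ x }
  refine (rs_extClass hS₁ hS φ b h).trans ?_
  have h5 : τ₁ = W.subtype ∘ₗ τ₁.codRestrict W hτ := rfl
  have hz : rs (ModuleCat.ofHom τ₁) b = 0 := by
    rw [h5, ModuleCat.ofHom_comp, ← rs_rs, hb, rs_zero]
  change hS₁.extClass.comp (rs (ModuleCat.ofHom τ₁) b) h = 0
  rw [hz, Ext.comp_zero]

lemma rs_extClass_zero' {B₁ C₁ A₂ B₂ C₂ : Type} [AddCommGroup B₁] [AddCommGroup C₁]
    [AddCommGroup A₂] [AddCommGroup B₂] [AddCommGroup C₂] [Module R B₁] [Module R C₁]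
    [Module R A₂] [Module R B₂] [Module R C₂] (g₁ : B₁ →ₗ[R] C₁)
    (f₂ : A₂ →ₗ[R] B₂) (g₂ : B₂ →ₗ[R] C₂) (hg₁ : Function.Surjective g₁)
    (hf₂ : Function.Injective f₂)
    (h₂ : Function.Exact f₂ g₂) (hS : (sc f₂ g₂ h₂).ShortExact)
    (τ₂ : B₁ →ₗ[R] B₂) (τ₃ : C₁ →ₗ[R] C₂)
    (c₂ : ∀ x, g₂ (τ₂ x) = τ₃ (g₁ x)) (W : Submodule R A₂)
    (hτ : ∀ x, g₁ x = 0 → ∃ w ∈ W, f₂ w = τ₂ x) 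
    {N : ModuleCat.{0} R} {i j : ℕ} (b : NE (ModuleCat.of R A₂) N i) (h : 1 + i = j)
    (hb : rs (ModuleCat.ofHom W.subtype) b = 0) :
    rs (ModuleCat.ofHom τ₃) (hS.extClass.comp b h) = 0 := by
  have hr : ∀ x : LinearMap.ker g₁, (τ₂ ∘ₗ (LinearMap.ker g₁).subtype) x ∈ LinearMap.range f₂ := by
    rintro ⟨x, hx⟩
    obtain ⟨w, -, hw⟩ := hτ x hx
    exact ⟨w, hw⟩
  let τ₁ : LinearMap.ker g₁ →ₗ[R] A₂ := (LinearEquiv.ofInjective f₂ hf₂).symm.toLinearMap ∘ₗ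
    LinearMap.codRestrict _ (τ₂ ∘ₗ (LinearMap.ker g₁).subtype) hr
  have hτ₁ : ∀ x, f₂ (τ₁ x) = τ₂ x := by
    intro x
    have h1 : LinearEquiv.ofInjective f₂ hf₂ (τ₁ x) = 
      LinearMap.codRestrict _ (τ₂ ∘ₗ (LinearMap.ker g₁).subtype) hr x := by simp [τ₁]
    exact congrArg Subtype.val h1
  refine rs_extClass_zero (LinearMap.ker g₁).subtype g₁ f₂ g₂ Subtype.val_injective hg₁ 
    (fun x => by simp) h₂ hS τ₁ τ₂ τ₃ hτ₁ c₂ W ?_ b h hb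
  intro x
  obtain ⟨w, hw, hw'⟩ := hτ x x.2
  rw [← hτ₁] at hw'
  rw [← hf₂ hw']
  exact hw

lemma torsion_claim [IsNoetherianRing R] {N : Type} [AddCommGroup N] [Module R N]
    (hN : J ≤ Module.annihilator R N) (j : ℕ) : ∀ {A : Type} [AddCommGroup A] [Module R A] 
    [Module.Finite R A] (e : NE (ModuleCat.of R A) (ModuleCat.of R N) j),
    ∃ l : ℕ, rs (ModuleCat.ofHom (J ^ l • (⊤ : Submodule R A)).subtype) e = 0 := by
  induction j with
  | zero =>
    intro A _ _ _ e
    obtain ⟨f, rfl⟩ := (Ext.mk₀_bijective _ _).2 e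
    refine ⟨1, ?_⟩
    rw [rs_mk₀, mk₀_zero_iff]
    ext ⟨x, hx⟩
    change f.hom x = 0
    rw [pow_one] at hx
    refine Submodule.smul_induction_on hx ?_ ?_
    · intro r hr y _
      rw [map_smul]
      exact Module.mem_annihilator.1 (hN hr) _
    · intro x y hx hy
      rw [map_add, hx, hy, add_zero]
  | succ j ih =>
    intro A _ _ _ e
    obtain ⟨a, π, hπ⟩ := Module.Finite.exists_fin' R A
    have hex : Function.Exact (LinearMap.ker π).subtype π := fun x => by simp
    have hS := sc_exact Subtype.val_injective hπ hex
    have : Projective (ModuleCat.of R (Fin a → R)) := 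
      (IsProjective.iff_projective _).1 inferInstance
    obtain ⟨b, rfl⟩ := Ext.contravariant_sequence_exact₃ hS _ e (Ext.eq_zero_of_projective _) 
      (add_comm 1 j)
    obtain ⟨l, hl⟩ := ih b
    obtain ⟨k, hk⟩ := J.exists_pow_inf_eq_pow_smul (LinearMap.ker π)
    have hk' := hk (k + l) (by omega)
    refine ⟨k + l, ?_⟩
    obtain ⟨F', hF'⟩ : ∃ F' : Submodule R (Fin a → R), F' = J ^ (k + l) • ⊤ := ⟨_, rfl⟩
    obtain ⟨A', hA'⟩ : ∃ A' : Submodule R A, A' = J ^ (k + l) • ⊤ := ⟨_, rfl⟩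
    rw [← hA']
    have hmap : Submodule.map π F' = A' := by
      rw [hF', hA', Submodule.map_smul'']
      rw [Submodule.map_top, LinearMap.range_eq_top.2 hπ]
    let π' : F' →ₗ[R] A' := π.restrict (by
      intro x hx
      rw [← hmap]; exact Submodule.mem_map_of_mem hx)
    have hπ' : Function.Surjective π' := by
      rintro ⟨y, hy⟩
      rw [← hmap] at hy
      obtain ⟨x, hx, rfl⟩ := hy
      exact ⟨⟨x, hx⟩, rfl⟩
    refine rs_extClass_zero' π' (LinearMap.ker π).subtype π 
      hπ' Subtype.val_injective hex hS F'.subtype A'.subtype (fun _ => rfl) 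
      _ ?_ b (add_comm 1 j) hl
    intro x hx
    have h1 : (x : Fin a → R) ∈ J ^ (k + l) • ⊤ ⊓ LinearMap.ker π := 
      ⟨hF' ▸ x.2, congrArg Subtype.val hx⟩
    rw [hk', Nat.add_sub_cancel_left] at h1
    have h2 : (x : Fin a → R) ∈ J ^ l • LinearMap.ker π := 
      Submodule.smul_mono le_rfl inf_le_right h1
    have h3 : J ^ l • LinearMap.ker π = 
        Submodule.map (LinearMap.ker π).subtype (J ^ l • ⊤) := by
      rw [Submodule.map_smul'', Submodule.map_top, Submodule.range_subtype]
    rw [h3] at h2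
    exact h2

lemma V_of_torsion [IsNoetherianRing R] {N : Type} [AddCommGroup N] [Module R N]
    (hN : J ≤ Module.annihilator R N) (j : ℕ) : V J (j+1) (ModuleCat.of R N) := by
  rw [V_def]
  intro k e
  have hex (k : ℕ) : Function.Exact (J ^ k).subtype (J ^ k).mkQ := fun x => by simp [Ideal.Quotient.eq_zero_iff_mem]
  have hS (k : ℕ) := sc_exact Subtype.val_injective (J ^ k).mkQ_surjective (hex k)
  have : Projective (ModuleCat.of R R) := (IsProjective.iff_projective _).1 inferInstance
  obtain ⟨b, rfl⟩ := Ext.contravariant_sequence_exact₃ (hS k) _ e (Ext.eq_zero_of_projective _) 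
      (add_comm 1 j)
  obtain ⟨l, hl⟩ := torsion_claim J hN j b
  have hle : J ^ (l + k) ≤ J ^ k := Ideal.pow_le_pow_right (by omega)
  refine ⟨l + k, by omega, ?_⟩
  refine rs_extClass_zero' (J ^ (l + k)).mkQ _ _ (J ^ (l + k)).mkQ_surjective Subtype.val_injective
    (hex k) (hS k) LinearMap.id _ (fun _ => rfl) _ ?_ b (add_comm 1 j) hl
  intro x hx
  have h3 : J ^ (l + k) = Submodule.map (J ^ k).subtype (J ^ l • ⊤) := by
    rw [Submodule.map_smul'', Submodule.map_top, Submodule.range_subtype, pow_add]; rfl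
  rw [Submodule.mkQ_apply, Submodule.Quotient.mk_eq_zero, h3] at hx
  exact hx

lemma V_bounded (n : ℕ) (h : ∀ k, ∃ I : Ideal R, I ≤ J ^ k ∧ (∃ l, J ^ l ≤ I) ∧ 
    HasProjectiveDimensionLT (ModuleCat.of R (R ⧸ I)) (n+1)) (N : ModuleCat.{0} R) (i : ℕ) 
    (hi : n < i) : V J i N := by
  rw [V_def]
  intro k e
  obtain ⟨I, hI, ⟨l, hl⟩, hpd⟩ := h k
  have hl' : J ^ (max l k) ≤ I := (Ideal.pow_le_pow_right (le_max_left _ _)).trans hl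
  refine ⟨max l k, le_max_right _ _, ?_⟩
  have : tr J (le_max_right l k) = ModuleCat.ofHom (Submodule.mapQ _ _ LinearMap.id hl') ≫ 
    ModuleCat.ofHom (Submodule.mapQ _ _ LinearMap.id hI) := by
    ext; rfl
  rw [this, ← rs_rs, Ext.eq_zero_of_hasProjectiveDimensionLT (rs (ModuleCat.ofHom (Submodule.mapQ I (J ^ k) LinearMap.id hI)) e) 
    (n+1) hi, rs_zero]

end Torsion
end LC

namespace LC
open Limits Opposite Abelian

section Koszul
variable {σ : Type} {K : Type} [Field K]

/-- The ideal generated by powers of variables. -/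
def pw (k : ℕ) (s : Finset σ) : Ideal (MvPolynomial σ K) :=
  Ideal.span ((fun d => monomial d (1 : K)) '' ((fun i => Finsupp.single i k) '' (s : Set σ)))

lemma X_mem_pw (k : ℕ) (s : Finset σ) (i : σ) (hi : i ∈ s) : (X i : MvPolynomial σ K) ^ k ∈ pw k s := by
  refine Ideal.subset_span ⟨_, ⟨i, hi, rfl⟩, ?_⟩
  simp [X_pow_eq_monomial]

lemma pw_le (k : ℕ) (s : Finset σ) (I : Ideal (MvPolynomial σ K)) (h : ∀ i ∈ s, X i ^ k ∈ I) :
    pw k s ≤ I := by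
  rw [pw, Ideal.span_le]
  rintro _ ⟨_, ⟨i, hi, rfl⟩, rfl⟩
  have := h i hi
  rw [X_pow_eq_monomial] at this
  exact this

lemma pw_insert [DecidableEq σ] (k : ℕ) (s : Finset σ) (a : σ) : (pw k (insert a s) : Ideal (MvPolynomial σ K)) =
    Ideal.span {X a ^ k} ⊔ pw k s := by
  apply le_antisymm
  · apply pw_le
    intro i hi
    rcases Finset.mem_insert.1 hi with rfl | hi
    · exact Ideal.mem_sup_left (Ideal.mem_span_singleton_self _)
    · exact Ideal.mem_sup_right (X_mem_pw k s i hi)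
  · refine sup_le ?_ ?_
    · rw [Ideal.span_singleton_le_iff_mem]
      exact X_mem_pw _ _ _ (Finset.mem_insert_self _ _)
    · exact pw_le _ _ _ fun i hi => X_mem_pw _ _ _ (Finset.mem_insert_of_mem hi)

lemma pw_regular (k : ℕ) (s : Finset σ) (a : σ) (ha : a ∉ s) (z : MvPolynomial σ K)
    (hz : X a ^ k * z ∈ pw k s) : z ∈ pw k s := by
  classical
  rw [pw, mem_ideal_span_monomial_image] at *
  intro d hd
  have hd' : Finsupp.single a k + d ∈ (X a ^ k * z).support := by
    rw [mem_support_iff] at hd ⊢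
    rw [X_pow_eq_monomial, coeff_monomial_mul, one_mul]
    exact hd
  obtain ⟨_, ⟨i, hi, rfl⟩, h⟩ := hz _ hd'
  refine ⟨_, ⟨i, hi, rfl⟩, ?_⟩
  have hia : a ≠ i := fun h => ha (h ▸ hi)
  dsimp only at h ⊢
  rw [Finsupp.single_le_iff] at h ⊢
  simpa [Finsupp.single_apply, hia] using h

lemma pw_pd (k : ℕ) (s : Finset σ) : HasProjectiveDimensionLT 
    (ModuleCat.of (MvPolynomial σ K) (MvPolynomial σ K ⧸ pw (K := K) k s)) (s.card + 1) := by
  classical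
  set R := MvPolynomial σ K
  induction s using Finset.induction_on with
  | empty =>
    have h0 : (pw k (∅ : Finset σ) : Ideal R) = ⊥ := by simp [pw]
    have : Module.Projective R (R ⧸ (pw k (∅ : Finset σ) : Ideal R)) := by
      rw [h0]
      exact Module.Projective.of_equiv (Submodule.quotEquivOfEqBot (⊥ : Submodule R R) rfl).symm
    have : Projective (ModuleCat.of R (R ⧸ (pw k (∅ : Finset σ) : Ideal R))) := 
      (IsProjective.iff_projective _).1 this
    simp only [Finset.card_empty, zero_add]
    infer_instance
  | insert a s ha ih =>
    rw [Finset.card_insert_of_notMem ha]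
    have hle : (pw k s : Ideal R) ≤ pw k (insert a s) := by rw [pw_insert]; exact le_sup_right
    let f : (R ⧸ (pw k s : Ideal R)) →ₗ[R] (R ⧸ (pw k s : Ideal R)) := 
      LinearMap.lsmul R _ (X a ^ k)
    let g : (R ⧸ (pw k s : Ideal R)) →ₗ[R] (R ⧸ (pw k (insert a s) : Ideal R)) := 
      Submodule.mapQ _ _ LinearMap.id hle
    have hf : Function.Injective f := by
      rw [injective_iff_map_eq_zero]
      intro z hz
      obtain ⟨z, rfl⟩ := Ideal.Quotient.mk_surjective z
      have : Ideal.Quotient.mk (pw k s) (X a ^ k * z) = 0 := hz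
      rw [Ideal.Quotient.eq_zero_iff_mem] at this ⊢
      exact pw_regular _ _ _ ha _ this
    have hg : Function.Surjective g := by
      intro y
      obtain ⟨y, rfl⟩ := Ideal.Quotient.mk_surjective y
      exact ⟨Ideal.Quotient.mk _ y, rfl⟩
    have hex : Function.Exact f g := by
      intro y
      obtain ⟨y, rfl⟩ := Ideal.Quotient.mk_surjective y
      have h1 : g (Ideal.Quotient.mk _ y) = Ideal.Quotient.mk _ y := rfl
      rw [h1, Ideal.Quotient.eq_zero_iff_mem, pw_insert]
      constructor
      · intro hy
        obtain ⟨u, hu, v, hv, rfl⟩ := Submodule.mem_sup.1 hy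
        obtain ⟨w, rfl⟩ := Ideal.mem_span_singleton'.1 hu
        refine ⟨Ideal.Quotient.mk _ w, ?_⟩
        change Ideal.Quotient.mk _ (X a ^ k * w) = _
        rw [Ideal.Quotient.eq]
        have : X a ^ k * w - (w * X a ^ k + v) = - v := by ring
        rw [this]
        exact neg_mem hv
      · rintro ⟨w, hw⟩
        obtain ⟨w, rfl⟩ := Ideal.Quotient.mk_surjective w
        change Ideal.Quotient.mk _ (X a ^ k * w) = _ at hw
        rw [Ideal.Quotient.eq] at hw
        have : y = X a ^ k * w - (X a ^ k * w - y) := by ring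
        rw [this]
        exact sub_mem (Ideal.mem_sup_left (Ideal.mul_mem_right _ _ (Ideal.mem_span_singleton_self _)))
          (Ideal.mem_sup_right hw)
    have hS := sc_exact hf hg hex
    refine hS.hasProjectiveDimensionLT_X₃ (s.card + 1) ih ?_
    exact hasProjectiveDimensionLT_of_ge _ (s.card + 1) _ (by omega)

lemma V_idealQ (m n : ℕ) (N : ModuleCat.{0} (BGS K m n)) (i : ℕ) (hi : n < i) : V (idealQ K m n) i N := by
  classical
  refine V_bounded _ n (fun k => ?_) N i hi
  let s : Finset (Fin m ⊕ Fin n) := (Finset.univ : Finset (Fin n)).map Function.Embedding.inr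
  have hs : s.card = n := by simp [s]
  refine ⟨pw k s, ?_, ?_, ?_⟩
  · apply pw_le
    intro i hi
    simp [s] at hi
    obtain ⟨j, rfl⟩ := hi
    have hj : (X (Sum.inr j) : BGS K m n) ∈ idealQ K m n := Ideal.subset_span ⟨j, rfl⟩
    exact Ideal.pow_mem_pow hj k
  · apply Ideal.exists_pow_le_of_le_radical_of_fg
    · rw [idealQ, Ideal.span_le]
      rintro _ ⟨j, rfl⟩
      exact ⟨k, X_mem_pw _ _ _ (by simp [s])⟩
    · exact IsNoetherian.noetherian _
  · have := pw_pd (K := K) k s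
    rwa [hs] at this

end Koszul
end LC

namespace LC
open Limits Opposite Abelian

section Grading
variable {K : Type} [Field K] {m n : ℕ} {M : Type} [AddCommGroup M] [Module (BGS K m n) M]
  {ℳ : ℕ × ℕ → AddSubgroup M}

lemma graded_nak (hM : IsBigrading K m n M ℳ) (q : BGS K m n) (hq : q ∈ idealQ K m n) (x : M)
    (hx : x = q • x) : x = 0 := by
  classical
  let _ := hM.internal.chooseDecomposition
  let F : ℕ → AddSubgroup M := fun k =>
    { carrier := {x | ∀ e : ℕ × ℕ, e.2 < k → (DirectSum.decompose ℳ x e : M) = 0}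
      add_mem' := by
        intro a b ha hb e he
        simp [DirectSum.decompose_add, ha e he, hb e he]
      zero_mem' := by intro e he; simp
      neg_mem' := by
        intro a ha e he
        rw [DirectSum.decompose_neg]
        change -((DirectSum.decompose ℳ a e : ℳ e) : M) = 0
        rw [ha e he, neg_zero] }
  have hF : ∀ k x, x ∈ F k ↔ ∀ e : ℕ × ℕ, e.2 < k → (DirectSum.decompose ℳ x e : M) = 0 := 
    fun _ _ => Iff.rfl
  have hmem : ∀ k (e : ℕ × ℕ) (y : M), y ∈ ℳ e → k ≤ e.2 → y ∈ F k := by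
    intro k e y hy hk e' he'
    rw [DirectSum.decompose_of_mem_ne ℳ hy]
    rintro rfl
    omega
  have hhom : ∀ (d : ℕ × ℕ) (s : BGS K m n) k y, IsWeightedHomogeneous (bwt m n) s d → 
      y ∈ F k → s • y ∈ F (k + d.2) := by
    intro d s k y hs hy
    rw [← DirectSum.sum_support_decompose ℳ y, Finset.smul_sum]
    refine sum_mem fun e _ => ?_
    by_cases he : e.2 < k
    · rw [hy e he, smul_zero]; exact zero_mem _
    · refine hmem _ (d + e) _ (hM.smul_mem d e s _ hs (SetLike.coe_mem _)) ?_
      simp only [Prod.snd_add]; omega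
  have hmono : ∀ k y, y ∈ F (k+1) → y ∈ F k := fun k y hy e he => hy e (by omega)
  have hsm : ∀ (s : BGS K m n) k y, y ∈ F k → s • y ∈ F k := by
    intro s k y hy
    rw [← MvPolynomial.support_sum_monomial_coeff s, Finset.sum_smul]
    refine sum_mem fun d _ => ?_
    have h1 := hhom _ _ k y (isWeightedHomogeneous_monomial (bwt m n) d (coeff d s) rfl) hy
    intro e he
    exact h1 e (by omega)
  have hq' : ∀ k y, y ∈ F k → q • y ∈ F (k + 1) := by
    intro k y hy
    refine Submodule.span_induction (p := fun q _ => q • y ∈ F (k+1)) ?_ ?_ ?_ ?_ hq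
    · rintro _ ⟨j, rfl⟩
      exact hhom (0, 1) _ k y (isWeightedHomogeneous_X K (bwt m n) (Sum.inr j)) hy
    · rw [zero_smul]; exact zero_mem _
    · intro a b _ _ ha hb
      rw [add_smul]; exact add_mem ha hb
    · intro a b _ hb
      rw [smul_eq_mul, mul_smul]; exact hsm _ _ _ hb
  have hall : ∀ k, x ∈ F k := by
    intro k
    induction k with
    | zero => intro e he; omega
    | succ k ih => rw [hx]; exact hq' k x ih
  rw [← DirectSum.sum_support_decompose ℳ x]
  exact Finset.sum_eq_zero fun e _ => hall (e.2 + 1) e (by omega)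

lemma cohDim_le {N : Type} [AddCommGroup N] [Module (BGS K m n) N] (c : ℕ)
    (h : ∀ i > c, V (idealQ K m n) i (ModuleCat.of _ N)) : cohDim (BGS K m n) (idealQ K m n) N ≤ c := by
  refine csSup_le' ?_
  intro i hi
  by_contra! hlt
  obtain ⟨j, rfl⟩ : ∃ j, i = j + 1 := ⟨i - 1, by omega⟩
  exact (nontrivial_lc _ j _).1 hi (h _ hlt)

lemma V_of_cohDim_le {N : Type} [AddCommGroup N] [Module (BGS K m n) N] (c : ℕ)
    (h : cohDim (BGS K m n) (idealQ K m n) N ≤ c) (i : ℕ) (hi : c < i) : 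
    V (idealQ K m n) i (ModuleCat.of _ N) := by
  by_contra hV
  obtain ⟨j, rfl⟩ : ∃ j, i = j + 1 := ⟨i - 1, by omega⟩
  have hbd : BddAbove {i : ℕ | Nontrivial ((localCohomology (idealQ K m n) i).obj 
      (ModuleCat.of (BGS K m n) N))} := by
    refine ⟨n, ?_⟩
    intro i hi
    by_contra! hlt
    obtain ⟨j, rfl⟩ : ∃ j, i = j + 1 := ⟨i - 1, by omega⟩
    exact (nontrivial_lc _ j _).1 hi (V_idealQ m n _ _ hlt)
  have := le_csSup hbd (show j + 1 ∈ _ from (nontrivial_lc _ j _).2 hV)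
  unfold cohDim at h
  omega

end Grading
end LC

theorem maximalDepth_of_cohDim_le_one
    (K : Type) [Field K] [Infinite K] (m n : ℕ)
    (M : Type) [AddCommGroup M] [Module (BGS K m n) M] [Module.Finite (BGS K m n) M]
    [Nontrivial M]
    (ℳ : ℕ × ℕ → AddSubgroup M) (hM : IsBigrading K m n M ℳ)
    (h : cohDim (BGS K m n) (idealQ K m n) M ≤ 1) :
    HasMaximalDepth (BGS K m n) (idealQ K m n) M := by
  classical
  let J := idealQ K m n
  have hb : ∀ i > n, ∀ (N : Type) [AddCommGroup N] [Module (BGS K m n) N] 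
      [Module.Finite (BGS K m n) N], LC.V J i (ModuleCat.of (BGS K m n) N) :=
    fun i hi N _ _ _ => LC.V_idealQ m n _ i hi
  have hVM : ∀ i ≥ 2, LC.V J i (ModuleCat.of (BGS K m n) M) := 
    fun i hi => LC.V_of_cohDim_le 1 h i hi
  have hass : ∀ p ∈ associatedPrimes (BGS K m n) M, p.IsPrime ∧ 
      ∃ y : M, y ≠ 0 ∧ ∀ r, r ∈ p ↔ r • y = 0 := by
    intro p hp
    have hp' := AssociatedPrimes.mem_iff.1 hp
    have hpr := hp'.isPrime
    obtain ⟨-, y, hy⟩ := isAssociatedPrime_iff.1 hp'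
    have hy' : ∀ r, r ∈ p ↔ r • y = 0 := by
      intro r
      rw [hy, Submodule.mem_colon_singleton, Submodule.mem_bot]
    refine ⟨hpr, y, ?_, hy'⟩
    rintro rfl
    exact hpr.ne_top ((Ideal.eq_top_iff_one _).2 ((hy' 1).2 (smul_zero _)))
  have hann : ∀ p ∈ associatedPrimes (BGS K m n) M, Module.annihilator (BGS K m n) M ≤ p := by
    intro p hp r hr
    obtain ⟨-, y, -, hy'⟩ := hass p hp
    exact (hy' r).2 (Module.mem_annihilator.1 hr y)
  have hnt : ∀ p ∈ associatedPrimes (BGS K m n) M, Nontrivial (BGS K m n ⧸ (p ⊔ J)) := by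
    intro p hp
    refine Ideal.Quotient.nontrivial_iff.2 fun htop => ?_
    obtain ⟨-, y, hy, hy'⟩ := hass p hp
    obtain ⟨a, ha, q, hq, haq⟩ := Submodule.mem_sup.1 ((Ideal.eq_top_iff_one _).1 htop)
    refine hy (LC.graded_nak hM q hq y ?_)
    calc y = (1 : BGS K m n) • y := (one_smul _ _).symm
      _ = q • y := by rw [← haq, add_smul, (hy' a).1 ha, zero_add]
  have hnV : ∀ p ∈ associatedPrimes (BGS K m n) M, 
      ¬ LC.V J 0 (ModuleCat.of (BGS K m n) (BGS K m n ⧸ (p ⊔ J))) := by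
    intro p hp
    have := hnt p hp
    refine LC.not_V_zero J ?_
    rw [Ideal.annihilator_quotient]
    exact le_sup_right
  unfold HasMaximalDepth
  by_cases hT : ∃ x : M, x ≠ 0 ∧ ∀ a ∈ J, a • x = 0
  · obtain ⟨x, hx, hJx⟩ := hT
    have h1 : extGrade (BGS K m n) (idealQ K m n) M = 0 := by
      refine Nat.le_zero.1 (Nat.sInf_le ?_)
      refine LC.nontrivial_OE_zero.2 ⟨ModuleCat.ofHom (Submodule.liftQ _ 
        (LinearMap.toSpanSingleton (BGS K m n) M x) ?_), ?_⟩
      · intro r hr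
        rw [LinearMap.mem_ker, LinearMap.toSpanSingleton_apply]
        exact hJx r hr
      · intro h0
        have h1 := congrArg (fun t => t.hom (Submodule.Quotient.mk 1)) h0
        have h2 : (1 : BGS K m n) • x = 0 := h1
        exact hx (by rwa [one_smul] at h2)
    have h2 : mCohDim (BGS K m n) (idealQ K m n) M = 0 := by
      obtain ⟨p, hp, hxp⟩ := exists_le_isAssociatedPrime_of_isNoetherianRing (BGS K m n) x hx
      have h3 : cohDim (BGS K m n) (idealQ K m n) (BGS K m n ⧸ p) = 0 := by
        refine Nat.le_zero.1 (LC.cohDim_le 0 fun i hi => ?_)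
        obtain ⟨j, rfl⟩ : ∃ j, i = j + 1 := ⟨i - 1, by omega⟩
        refine LC.V_of_torsion _ ?_ j
        rw [Ideal.annihilator_quotient]
        refine le_trans ?_ hxp
        intro a ha
        rw [Submodule.mem_colon_singleton, Submodule.mem_bot]
        exact hJx a ha
      exact Nat.le_zero.1 (Nat.sInf_le ⟨p, hp, h3⟩)
    rw [h1, h2]
  · have tf : ∀ x : M, (∀ a ∈ J, a • x = 0) → x = 0 := by
      intro x hx
      by_contra hne
      exact hT ⟨x, hne, hx⟩
    obtain ⟨p₀, hp₀⟩ := associatedPrimes.nonempty (BGS K m n) M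
    have h1 : extGrade (BGS K m n) (idealQ K m n) M = 1 := by
      have hmem : 1 ∈ {i : ℕ | Nontrivial (((Ext (BGS K m n) (ModuleCat (BGS K m n)) i).obj 
          (Opposite.op (ModuleCat.of (BGS K m n) (BGS K m n ⧸ idealQ K m n)))).obj 
            (ModuleCat.of (BGS K m n) M))} := by
        refine LC.nontrivial_OE_succ.2 ?_
        by_contra! hall
        refine hnV p₀ hp₀ (LC.support_thm J n 0 hb M ?_ 0 le_rfl _ ?_)
        · intro i _
          rcases i with _ | _ | i
          · exact LC.V_zero_of_tf J tf
          · exact LC.V_one_of J tf hall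
          · exact hVM _ (by omega)
        · rw [Ideal.annihilator_quotient]
          exact (hann p₀ hp₀).trans le_sup_left
      refine le_antisymm (Nat.sInf_le hmem) ?_
      by_contra! hlt
      have h0 := Nat.sInf_mem ⟨1, hmem⟩
      have h0' : extGrade (BGS K m n) (idealQ K m n) M = 0 := by omega
      unfold extGrade at h0'
      rw [h0'] at h0
      obtain ⟨f, hf⟩ := LC.nontrivial_OE_zero.1 h0
      apply hf
      rw [← LC.mk₀_zero_iff]
      refine LC.hom_zero_of_tf J tf 1 ?_ _
      change J ^ 1 ≤ Module.annihilator (BGS K m n) (BGS K m n ⧸ J)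
      rw [Ideal.annihilator_quotient, pow_one]
    have hcd : ∀ p ∈ associatedPrimes (BGS K m n) M, 
        cohDim (BGS K m n) (idealQ K m n) (BGS K m n ⧸ p) = 1 := by
      intro p hp
      obtain ⟨hpr, y, hy, hy'⟩ := hass p hp
      refine le_antisymm (LC.cohDim_le 1 fun i hi => ?_) ?_
      · refine LC.support_thm J n 2 hb M hVM i hi _ ?_
        rw [Ideal.annihilator_quotient]
        exact hann p hp
      · by_contra! hlt
        refine hnV p hp (LC.support_thm J n 0 hb (BGS K m n ⧸ p) ?_ 0 le_rfl _ ?_)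
        · intro i _
          rcases i with _ | i
          · refine LC.V_zero_of_tf J ?_
            intro z hz
            obtain ⟨z, rfl⟩ := Ideal.Quotient.mk_surjective z
            by_contra hzp
            rw [Ideal.Quotient.eq_zero_iff_mem] at hzp
            refine hy (tf y fun a ha => (hy' a).1 ?_)
            have h3 : Ideal.Quotient.mk p (a * z) = 0 := hz a ha
            rw [Ideal.Quotient.eq_zero_iff_mem] at h3
            exact (hpr.mem_or_mem h3).resolve_right hzp
          · exact LC.V_of_cohDim_le 0 (by omega) _ (by omega)
        · rw [Ideal.annihilator_quotient, Ideal.annihilator_quotient]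
          exact le_sup_left
    have h2 : mCohDim (BGS K m n) (idealQ K m n) M = 1 := by
      have hne : ((fun p => cohDim (BGS K m n) (idealQ K m n) (BGS K m n ⧸ p)) '' 
        associatedPrimes (BGS K m n) M).Nonempty := ⟨_, p₀, hp₀, rfl⟩
      obtain ⟨p, hp, hp'⟩ := Nat.sInf_mem hne
      exact hp'.symm.trans (hcd p hp)
    rw [h1, h2]
end
end

section
/- For every nonzero finitely generated bigraded S-module M one has the chain of inequalities grade(Q, M) ≤ mgrade(Q, M) ≤ cd(Q, M) ≤ dim M; moreover, grade(Q, M) = 0 if and only if mgrade(Q, M) = 0, and if mgrade(Q, M) = 1 then grade(Q, M) = 1. -/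
open CategoryTheory MvPolynomial

noncomputable section

namespace GM
open CategoryTheory.Limits

lemma abs_nat {C : Type*} [Category C] {A A' B B' D D' : C} (a : A ⟶ A') (i' : A' ≅ B')
    (i : A ≅ B) (b : B ⟶ B') (j : D ≅ B) (j' : D' ≅ B') (d : D ⟶ D')
    (h1 : a ≫ i'.hom = i.hom ≫ b) (h2 : d ≫ j'.hom = j.hom ≫ b) :
    a ≫ (i' ≪≫ j'.symm).hom = (i ≪≫ j.symm).hom ≫ d := by
  simp only [Iso.trans_hom, Iso.symm_hom, Category.assoc]
  rw [← Category.assoc, h1, Category.assoc]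
  congr 1
  rw [Iso.eq_inv_comp, ← Category.assoc, ← h2]; simp

section oldExt
variable {R : Type} [CommRing R]
variable {X X' Y : ModuleCat.{0} R}

/-- the morphism of cochain complexes induced by a morphism of chain complexes -/
def yonMap {A B : ChainComplex (ModuleCat.{0} R) ℕ} (φ : A ⟶ B) (Y : ModuleCat.{0} R) :
    B.linearYonedaObj R Y ⟶ A.linearYonedaObj R Y :=
  (HomologicalComplex.unopFunctor _ _).map
    (((((linearYoneda R (ModuleCat.{0} R)).obj Y).rightOp.mapHomologicalComplex _).map φ).op)

lemma isoExt_naturality (P : ProjectiveResolution X) (P' : ProjectiveResolution X')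
    (g : X' ⟶ X) (φ : ProjectiveResolution.Hom P' P g) (n : ℕ) :
    ((Ext R (ModuleCat.{0} R) n).map g.op).app Y ≫ (P'.isoExt n Y).hom =
      (P.isoExt n Y).hom ≫ HomologicalComplex.homologyMap (yonMap φ.hom Y) n := by
  have h1 := ProjectiveResolution.isoLeftDerivedObj_inv_naturality g P' P φ.hom
    φ.hom_f_zero_comp_π_f_zero ((linearYoneda R (ModuleCat.{0} R)).obj Y).rightOp n
  have h2 := HomologicalComplex.homologyOp_hom_naturality (yonMap φ.hom Y) n
  have h1' := congrArg Quiver.Hom.unop h1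
  have h2' := congrArg Quiver.Hom.unop h2
  exact abs_nat _ (P'.isoLeftDerivedObj ((linearYoneda R (ModuleCat.{0} R)).obj Y).rightOp n).unop.symm
    (P.isoLeftDerivedObj ((linearYoneda R (ModuleCat.{0} R)).obj Y).rightOp n).unop.symm _
    (HomologicalComplex.homologyUnop _ _) (HomologicalComplex.homologyUnop _ _) _ h1' h2'.symm

lemma homologyπ_zero_iff (K : CochainComplex (ModuleCat.{0} R) ℕ) (n : ℕ) (z : K.cycles n) :
    K.homologyπ n z = 0 ↔ ∃ w : K.X ((ComplexShape.up ℕ).prev n),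
      K.d ((ComplexShape.up ℕ).prev n) n w = K.iCycles n z := by
  have hex := ShortComplex.exact_of_g_is_cokernel
    (ShortComplex.mk (K.toCycles ((ComplexShape.up ℕ).prev n) n) (K.homologyπ n) (by simp))
    (K.homologyIsCokernel _ n rfl)
  rw [ShortComplex.moduleCat_exact_iff] at hex
  have hinj : Function.Injective (K.iCycles n) := (ModuleCat.mono_iff_injective _).1 inferInstance
  constructor
  · intro h
    obtain ⟨w, hw⟩ := hex z h
    refine ⟨w, ?_⟩
    rw [← hw, ← K.toCycles_i]; rfl
  · rintro ⟨w, hw⟩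
    have : K.toCycles ((ComplexShape.up ℕ).prev n) n w = z := by
      apply hinj
      rw [← hw, ← K.toCycles_i]; rfl
    rw [← this, ← ConcreteCategory.comp_apply]
    simp

lemma cycles_exists (K : CochainComplex (ModuleCat.{0} R) ℕ) (n : ℕ) (f : K.X n)
    (hf : K.d n (n+1) f = 0) : ∃ z : K.cycles n, K.iCycles n z = f := by
  have hex := ShortComplex.exact_of_f_is_kernel
    (ShortComplex.mk (K.iCycles n) (K.d n (n+1)) (by simp))
    (K.cyclesIsKernel n (n+1) (by simp))
  rw [ShortComplex.moduleCat_exact_iff] at hex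
  exact hex f hf

/-- `x` in the old Ext is represented by the cocycle `f`. -/
def Rel (P : ProjectiveResolution X) (n : ℕ)
    (x : ((Ext R (ModuleCat.{0} R) n).obj (Opposite.op X)).obj Y) (f : P.complex.X n ⟶ Y) : Prop :=
  ∃ z : (P.complex.linearYonedaObj R Y).cycles n,
    (P.complex.linearYonedaObj R Y).iCycles n z = f ∧
    (P.complex.linearYonedaObj R Y).homologyπ n z = (P.isoExt n Y).hom x

lemma rel_exists (P : ProjectiveResolution X) (n : ℕ)
    (x : ((Ext R (ModuleCat.{0} R) n).obj (Opposite.op X)).obj Y) :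
    ∃ f : P.complex.X n ⟶ Y, P.complex.d (n+1) n ≫ f = 0 ∧ Rel P n x f := by
  have hs : Function.Surjective ((P.complex.linearYonedaObj R Y).homologyπ n) :=
    (ModuleCat.epi_iff_surjective _).1 inferInstance
  obtain ⟨z, hz⟩ := hs ((P.isoExt n Y).hom x)
  refine ⟨(P.complex.linearYonedaObj R Y).iCycles n z, ?_, z, rfl, hz⟩
  have : ((P.complex.linearYonedaObj R Y).iCycles n ≫
    (P.complex.linearYonedaObj R Y).d n (n+1)) z = 0 := by
    rw [HomologicalComplex.iCycles_d]; rfl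
  exact this

lemma rel_exists' (P : ProjectiveResolution X) (n : ℕ) (f : P.complex.X n ⟶ Y)
    (hf : P.complex.d (n+1) n ≫ f = 0) :
    ∃ x : ((Ext R (ModuleCat.{0} R) n).obj (Opposite.op X)).obj Y, Rel P n x f := by
  obtain ⟨z, hz⟩ := cycles_exists (P.complex.linearYonedaObj R Y) n f hf
  exact ⟨(P.isoExt n Y).inv ((P.complex.linearYonedaObj R Y).homologyπ n z), z, hz, by simp⟩

lemma extMk_zero_iff' (P : ProjectiveResolution X) (f : P.complex.X 0 ⟶ Y)
    (hf : P.complex.d 1 0 ≫ f = 0) : P.extMk f 1 rfl hf = 0 ↔ f = 0 := by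
  constructor
  · intro h
    rw [← P.extEquivCohomologyClass.apply_eq_iff_eq,
      ProjectiveResolution.extEquivCohomologyClass_extMk,
      ProjectiveResolution.extEquivCohomologyClass_zero,
      CochainComplex.HomComplex.CohomologyClass.mk_eq_zero_iff] at h
    rw [CochainComplex.HomComplex.Cocycle.toSingleMk_mem_coboundaries_iff _ _ _ _ _ 1 (by simp)] at h
    obtain ⟨g, hg⟩ := h
    have : g = 0 := by
      apply IsZero.eq_of_src
      exact CochainComplex.isZero_of_isStrictlyLE _ 0 _ (by simp)
    rw [this, comp_zero] at hg
    rw [← cancel_epi (P.cochainComplexXIso (-(0:ℕ)) 0 rfl).hom, ← hg, comp_zero]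
  · rintro rfl
    simp

lemma rel_zero_iff (P : ProjectiveResolution X) (n : ℕ)
    (x : ((Ext R (ModuleCat.{0} R) n).obj (Opposite.op X)).obj Y) (f : P.complex.X n ⟶ Y)
    (hf : P.complex.d (n+1) n ≫ f = 0) (h : Rel P n x f) :
    x = 0 ↔ P.extMk f (n+1) rfl hf = 0 := by
  obtain ⟨z, hz, hx⟩ := h
  have h1 : x = 0 ↔ (P.isoExt n Y).hom x = 0 := by
    constructor
    · rintro rfl; simp
    · intro h
      have : (P.isoExt n Y).inv ((P.isoExt n Y).hom x) = 0 := by rw [h]; simp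
      simpa using this
  rw [h1, ← hx, homologyπ_zero_iff, hz]
  rcases n with _ | n
  · rw [extMk_zero_iff']
    constructor
    · rintro ⟨w, hw⟩
      rw [← hw, HomologicalComplex.shape]
      · rfl
      · simp
    · rintro rfl
      exact ⟨0, map_zero _⟩
  · rw [P.extMk_eq_zero_iff _ _ _ _ n rfl]
    have : (ComplexShape.up ℕ).prev (n+1) = n := by simp
    rw [this]
    rfl

lemma rel_naturality (P : ProjectiveResolution X) (P' : ProjectiveResolution X')
    (g : X' ⟶ X) (φ : ProjectiveResolution.Hom P' P g) (n : ℕ)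
    (x : ((Ext R (ModuleCat.{0} R) n).obj (Opposite.op X)).obj Y) (f : P.complex.X n ⟶ Y)
    (h : Rel P n x f) :
    Rel P' n (((Ext R (ModuleCat.{0} R) n).map g.op).app Y x) (φ.hom.f n ≫ f) := by
  obtain ⟨z, hz, hx⟩ := h
  refine ⟨HomologicalComplex.cyclesMap (yonMap φ.hom Y) n z, ?_, ?_⟩
  · rw [← ConcreteCategory.comp_apply, HomologicalComplex.cyclesMap_i, ConcreteCategory.comp_apply,
      hz]
    rfl
  · rw [← ConcreteCategory.comp_apply, ← HomologicalComplex.homologyπ_naturality,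
      ConcreteCategory.comp_apply, hx, ← ConcreteCategory.comp_apply,
      ← ConcreteCategory.comp_apply, isoExt_naturality P P' g φ]

lemma exists_hom (P : ProjectiveResolution X) (P' : ProjectiveResolution X') (g : X' ⟶ X) :
    Nonempty (ProjectiveResolution.Hom P' P g) :=
  ⟨⟨ProjectiveResolution.lift g P' P, by
    rw [← HomologicalComplex.comp_f, ProjectiveResolution.lift_commutes, HomologicalComplex.comp_f]⟩⟩

/-- transfer between the two Ext groups -/
lemma transfer (X Y : ModuleCat.{0} R) (n : ℕ) :
    (∀ x : ((Ext R (ModuleCat.{0} R) n).obj (Opposite.op X)).obj Y,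
      ∃ α : Abelian.Ext X Y n, (x = 0 ↔ α = 0) ∧ ∀ (X' : ModuleCat.{0} R) (g : X' ⟶ X),
        (((Ext R (ModuleCat.{0} R) n).map g.op).app Y x = 0 ↔
          (Abelian.Ext.mk₀ g).comp α (zero_add _) = 0)) ∧
    (∀ α : Abelian.Ext X Y n, ∃ x : ((Ext R (ModuleCat.{0} R) n).obj (Opposite.op X)).obj Y,
      (x = 0 ↔ α = 0) ∧ ∀ (X' : ModuleCat.{0} R) (g : X' ⟶ X),
        (((Ext R (ModuleCat.{0} R) n).map g.op).app Y x = 0 ↔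
          (Abelian.Ext.mk₀ g).comp α (zero_add _) = 0)) := by
  let P := projectiveResolution X
  have key : ∀ x f hf, Rel P (Y := Y) n x f →
      (x = 0 ↔ P.extMk f (n+1) rfl hf = 0) ∧ ∀ (X' : ModuleCat.{0} R) (g : X' ⟶ X),
        (((Ext R (ModuleCat.{0} R) n).map g.op).app Y x = 0 ↔
          (Abelian.Ext.mk₀ g).comp (P.extMk f (n+1) rfl hf) (zero_add _) = 0) := by
    intro x f hf h
    refine ⟨rel_zero_iff P n x f hf h, ?_⟩
    intro X' g
    let P' := projectiveResolution X'
    obtain ⟨φ⟩ := exists_hom P P' g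
    rw [ProjectiveResolution.mk₀_comp_extMk f _ _ hf φ]
    exact rel_zero_iff P' n _ _ _ (rel_naturality P P' g φ n x f h)
  constructor
  · intro x
    obtain ⟨f, hf, h⟩ := rel_exists P n x
    exact ⟨_, key x f hf h⟩
  · intro α
    obtain ⟨f, hf, rfl⟩ := P.extMk_surjective α (n+1) rfl
    obtain ⟨x, h⟩ := rel_exists' P n f hf
    exact ⟨x, key x f hf h⟩

lemma nontrivial_ext_iff (X Y : ModuleCat.{0} R) (n : ℕ) :
    Nontrivial (((Ext R (ModuleCat.{0} R) n).obj (Opposite.op X)).obj Y) ↔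
      ∃ α : Abelian.Ext X Y n, α ≠ 0 := by
  rw [nontrivial_iff_exists_ne 0]
  obtain ⟨h1, h2⟩ := transfer X Y n
  constructor
  · rintro ⟨x, hx⟩
    obtain ⟨α, hα, -⟩ := h1 x
    exact ⟨α, fun h => hx (hα.2 h)⟩
  · rintro ⟨α, hα⟩
    obtain ⟨x, hx, -⟩ := h2 α
    exact ⟨x, fun h => hα (hx.1 h)⟩

end oldExt

section LC
variable {R : Type} [CommRing R] (J : Ideal R)

/-- transition maps -/
def tr {s t : ℕ} (h : s ≤ t) : ModuleCat.of R (R ⧸ J ^ t) ⟶ ModuleCat.of R (R ⧸ J ^ s) :=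
  ModuleCat.ofHom (Submodule.mapQ _ _ LinearMap.id (Ideal.pow_le_pow_right h))

/-- vanishing of local cohomology -/
def V (i : ℕ) (N : ModuleCat.{0} R) : Prop :=
  ∀ (t : ℕ) (x : Abelian.Ext (ModuleCat.of R (R ⧸ J ^ t)) N i), ∃ (t' : ℕ) (h : t ≤ t'),
    (Abelian.Ext.mk₀ (tr J h)).comp x (zero_add _) = 0

lemma colim_subsingleton_iff (G : ℕᵒᵖᵒᵖ ⥤ ModuleCat.{0} R) (D : Cocone G) (hD : IsColimit D) :
    Subsingleton D.pt ↔ ∀ (t : ℕ) (x : G.obj (Opposite.op (Opposite.op t))),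
      ∃ (t' : ℕ) (h : t ≤ t'), G.map (homOfLE h).op.op x = 0 := by
  constructor
  · intro hs t x
    have : D.ι.app _ x = D.ι.app _ (0 : G.obj (Opposite.op (Opposite.op t))) :=
      @Subsingleton.elim D.pt hs _ _
    obtain ⟨k, f, g, hfg⟩ := (Concrete.isColimit_rep_eq_iff_exists G hD _ _).1 this
    rw [map_zero] at hfg
    exact ⟨k.unop.unop, f.unop.unop.down.down, hfg⟩
  · intro H
    constructor
    suffices H : ∀ a : D.pt, a = 0 from fun a b => (H a).trans (H b).symm
    intro a
    obtain ⟨j, y, rfl⟩ := Concrete.isColimit_exists_rep _ hD a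
    obtain ⟨t', h, h'⟩ := H j.unop.unop y
    have : D.ι.app j y = D.ι.app _ (G.map (homOfLE h).op.op y) := by
      rw [← D.w (homOfLE h).op.op]; rfl
    rw [this, h', map_zero]

lemma lc_nontrivial_iff (i : ℕ) (N : ModuleCat.{0} R) :
    Nontrivial ((localCohomology J i).obj N) ↔ ¬ V J i N := by
  let F := localCohomology.diagram (localCohomology.idealPowersDiagram J) i
  let c := colimit.cocone F
  let hc := isColimitOfPreserves ((evaluation _ _).obj N) (colimit.isColimit F)
  have h1 : ((localCohomology J i).obj N) = (((evaluation _ _).obj N).mapCocone c).pt := rfl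
  rw [h1, ← not_subsingleton_iff_nontrivial, not_iff_not, colim_subsingleton_iff _ _ hc]
  refine forall_congr' fun t => ?_
  obtain ⟨h2, h3⟩ := transfer (ModuleCat.of R (R ⧸ J ^ t)) N i
  constructor
  · intro H α
    obtain ⟨x, -, hx⟩ := h3 α
    obtain ⟨t', h, h'⟩ := H x
    exact ⟨t', h, (hx _ (tr J h)).1 h'⟩
  · intro H x
    obtain ⟨α, -, hα⟩ := h2 x
    obtain ⟨t', h, h'⟩ := H α
    exact ⟨t', h, (hα _ (tr J h)).2 h'⟩
end LC

end GM



namespace GM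
section Gam
variable {R : Type} [CommRing R] (J : Ideal R)

/-- the `J`-torsion submodule -/
def Gam (N : Type) [AddCommGroup N] [Module R N] : Submodule R N where
  carrier := {e | ∃ k : ℕ, ∀ r ∈ J ^ k, r • e = 0}
  add_mem' := by
    rintro a b ⟨k, hk⟩ ⟨l, hl⟩
    refine ⟨max k l, fun r hr => ?_⟩
    rw [smul_add, hk r (Ideal.pow_le_pow_right (le_max_left _ _) hr),
      hl r (Ideal.pow_le_pow_right (le_max_right _ _) hr), add_zero]
  zero_mem' := ⟨0, fun r _ => smul_zero r⟩
  smul_mem' := by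
    rintro c a ⟨k, hk⟩
    exact ⟨k, fun r hr => by rw [smul_comm, hk r hr, smul_zero]⟩

variable {N : Type} [AddCommGroup N] [Module R N]

lemma mem_gam {e : N} : e ∈ Gam J N ↔ ∃ k : ℕ, ∀ r ∈ J ^ k, r • e = 0 := Iff.rfl

lemma gam_uniform {P : Type} [AddCommGroup P] [Module R P] [Module.Finite R P]
    (f : P →ₗ[R] N) (h : ∀ x, f x ∈ Gam J N) : ∃ k : ℕ, ∀ r ∈ J ^ k, ∀ x, r • f x = 0 := by
  classical
  obtain ⟨s, hs⟩ := Module.Finite.fg_top (R := R) (M := P)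
  choose g hg using h
  refine ⟨s.sup g, fun r hr x => ?_⟩
  have hx : x ∈ Submodule.span R (s : Set P) := hs ▸ Submodule.mem_top
  induction hx using Submodule.span_induction with
  | mem x hx => exact hg x r (Ideal.pow_le_pow_right (Finset.le_sup hx) hr)
  | zero => simp
  | add x y _ _ hx hy => rw [map_add, smul_add, hx, hy, add_zero]
  | smul a x _ hx => rw [map_smul, smul_comm, hx, smul_zero]

lemma gam_baer [IsNoetherianRing R] (hN : Module.Baer R N) : Module.Baer R (Gam J N) := by
  intro I f
  obtain ⟨k, hk⟩ := gam_uniform J ((Gam J N).subtype ∘ₗ f) (fun x => (f x).2)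
  obtain ⟨k0, hk0⟩ := Ideal.exists_pow_inf_eq_pow_smul J (N := (I : Submodule R R))
  have h0 := hk0 (k0 + k) (by omega)
  have hz : ∀ x : I, (x : R) ∈ J ^ (k0 + k) → f x = 0 := by
    intro x hx
    have hx' : (x : R) ∈ J ^ k • (I : Submodule R R) := by
      have : (x : R) ∈ J ^ (k0 + k) • (⊤ : Submodule R R) ⊓ I := by
        refine ⟨?_, x.2⟩
        simpa using hx
      rw [h0, show k0 + k - k0 = k by omega] at this
      exact Submodule.smul_mono le_rfl inf_le_right this
    have key : ∀ y (hy : y ∈ J ^ k • (I : Submodule R R)), ∃ h : y ∈ I, f ⟨y, h⟩ = 0 := by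
      intro y hy
      refine Submodule.smul_induction_on hy ?_ ?_
      · intro r hr n hn
        refine ⟨I.mul_mem_left r hn, ?_⟩
        have e : (⟨r • n, I.mul_mem_left r hn⟩ : I) = r • ⟨n, hn⟩ := rfl
        rw [e, map_smul]
        exact Subtype.ext (hk r hr ⟨n, hn⟩)
      · rintro a b ⟨ha, ha'⟩ ⟨hb, hb'⟩
        refine ⟨I.add_mem ha hb, ?_⟩
        have e : (⟨a + b, I.add_mem ha hb⟩ : I) = ⟨a, ha⟩ + ⟨b, hb⟩ := rfl
        rw [e, map_add, ha', hb', add_zero]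
    exact (key x hx').2
  let q : I →ₗ[R] (R ⧸ J ^ (k0 + k)) := (Submodule.mkQ (J ^ (k0 + k))) ∘ₗ I.subtype
  have hq : LinearMap.ker q ≤ LinearMap.ker f := by
    intro x hx
    have hx' : Submodule.Quotient.mk (x : R) = (0 : R ⧸ J ^ (k0 + k)) := hx
    rw [Submodule.Quotient.mk_eq_zero] at hx'
    exact hz x hx'
  have hinj : Module.Injective R N := Module.Baer.injective hN
  obtain ⟨h, hh⟩ := hinj.out ((LinearMap.ker q).liftQ q le_rfl)
    (by rw [← LinearMap.ker_eq_bot]; exact Submodule.ker_liftQ_eq_bot _ _ _ le_rfl)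
    ((Gam J N).subtype ∘ₗ (LinearMap.ker q).liftQ f hq)
  refine ⟨LinearMap.codRestrict (Gam J N) (h ∘ₗ Submodule.mkQ (J ^ (k0 + k))) ?_, ?_⟩
  · intro c
    refine ⟨k0 + k, fun r hr => ?_⟩
    rw [← map_smul, LinearMap.comp_apply]
    have : Submodule.mkQ (J ^ (k0 + k)) (r • c) = 0 := by
      rw [Submodule.mkQ_apply, Submodule.Quotient.mk_eq_zero]
      exact Ideal.mul_mem_right _ _ hr
    rw [this, map_zero]
  · intro x hx
    apply Subtype.ext
    have := hh (Submodule.Quotient.mk ⟨x, hx⟩)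
    exact this

lemma gam_split [IsNoetherianRing R] (hN : Module.Baer R N) :
    ∃ s : (N ⧸ Gam J N) →ₗ[R] N, (Submodule.mkQ (Gam J N)) ∘ₗ s = LinearMap.id := by
  have hinj : Module.Injective R (Gam J N) := Module.Baer.injective (gam_baer J hN)
  obtain ⟨r, hr⟩ := hinj.out (Gam J N).subtype (Submodule.subtype_injective _) LinearMap.id
  refine ⟨(Gam J N).liftQ (LinearMap.id - (Gam J N).subtype ∘ₗ r) ?_, ?_⟩
  · intro x hx
    have := hr ⟨x, hx⟩
    simp only [Submodule.subtype_apply, LinearMap.id_apply] at this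
    simp [this]
  · ext x
    simp

lemma gam_quot_baer [IsNoetherianRing R] (hN : Module.Baer R N) :
    Module.Baer R (N ⧸ Gam J N) := by
  obtain ⟨s, hs⟩ := gam_split J hN
  intro I g
  obtain ⟨g', hg'⟩ := hN I (s ∘ₗ g)
  refine ⟨Submodule.mkQ (Gam J N) ∘ₗ g', fun x hx => ?_⟩
  rw [LinearMap.comp_apply, hg' x hx]
  exact LinearMap.congr_fun hs (g ⟨x, hx⟩)

lemma gam_quot_eq_bot [IsNoetherianRing R] : Gam J (N ⧸ Gam J N) = ⊥ := by
  rw [eq_bot_iff]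
  intro x hx
  obtain ⟨x, rfl⟩ := Submodule.Quotient.mk_surjective _ x
  obtain ⟨k, hk⟩ := hx
  rw [Submodule.mem_bot, Submodule.Quotient.mk_eq_zero]
  obtain ⟨l, hl⟩ := gam_uniform (P := ↥(J ^ k)) J
    ((LinearMap.toSpanSingleton R N x) ∘ₗ (Submodule.subtype (J ^ k)))
    (fun r => by
      have := hk r r.2
      rw [← Submodule.Quotient.mk_smul, Submodule.Quotient.mk_eq_zero] at this
      exact this)
  refine ⟨l + k, fun r hr => ?_⟩
  rw [pow_add] at hr
  refine Submodule.mul_induction_on hr ?_ ?_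
  · intro a ha b hb
    rw [mul_smul]
    exact hl a ha ⟨b, hb⟩
  · intro a b ha hb
    rw [add_smul, ha, hb, add_zero]

lemma injective_of_baer (hN : Module.Baer R N) : Injective (ModuleCat.of R N) := by
  rw [← Module.injective_iff_injective_object]
  exact Module.Baer.injective hN

lemma exists_baer (N : Type) [AddCommGroup N] [Module R N] :
    ∃ (E : Type) (_ : AddCommGroup E) (_ : Module R E) (f : N →ₗ[R] E),
      Module.Baer R E ∧ Function.Injective f := by
  let E := Injective.under (ModuleCat.of R N)
  refine ⟨E, inferInstance, inferInstance, (Injective.ι (ModuleCat.of R N)).hom, ?_, ?_⟩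
  · rw [Module.Baer.iff_injective, Module.injective_iff_injective_object]
    exact inferInstanceAs (Injective (Injective.under (ModuleCat.of R N)))
  · exact (ModuleCat.mono_iff_injective _).1 (Injective.ι_mono (ModuleCat.of R N))

/-- torsion-free embeds in torsion-free injective -/
lemma exists_baer_free [IsNoetherianRing R] (hN : Gam J N = ⊥) :
    ∃ (E : Type) (_ : AddCommGroup E) (_ : Module R E) (f : N →ₗ[R] E),
      Module.Baer R E ∧ Function.Injective f ∧ Gam J E = ⊥ := by
  obtain ⟨E, _, _, f, hE, hf⟩ := exists_baer (R := R) N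
  refine ⟨E ⧸ Gam J E, inferInstance, inferInstance, Submodule.mkQ _ ∘ₗ f, gam_quot_baer J hE,
    ?_, gam_quot_eq_bot J⟩
  rw [← LinearMap.ker_eq_bot, eq_bot_iff]
  intro x hx
  rw [LinearMap.mem_ker, LinearMap.comp_apply, Submodule.mkQ_apply,
    Submodule.Quotient.mk_eq_zero] at hx
  obtain ⟨k, hk⟩ := hx
  rw [← hN]
  refine ⟨k, fun r hr => hf ?_⟩
  rw [map_smul, hk r hr, map_zero]

/-- torsion embeds in torsion injective -/
lemma exists_baer_tors [IsNoetherianRing R] (hN : Gam J N = ⊤) :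
    ∃ (E : Type) (_ : AddCommGroup E) (_ : Module R E) (f : N →ₗ[R] E),
      Module.Baer R E ∧ Function.Injective f ∧ Gam J E = ⊤ := by
  obtain ⟨E, _, _, f, hE, hf⟩ := exists_baer (R := R) N
  refine ⟨Gam J E, inferInstance, inferInstance, LinearMap.codRestrict _ f ?_, gam_baer J hE,
    ?_, ?_⟩
  · intro c
    have : c ∈ Gam J N := hN ▸ Submodule.mem_top
    obtain ⟨k, hk⟩ := this
    exact ⟨k, fun r hr => by rw [← map_smul, hk r hr, map_zero]⟩
  · intro a b hab
    exact hf (congrArg Subtype.val hab)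
  · rw [eq_top_iff]
    rintro ⟨x, k, hk⟩ -
    exact ⟨k, fun r hr => Subtype.ext (hk r hr)⟩

end Gam
end GM



namespace GM
open Abelian
section Vex
variable {R : Type} [CommRing R] (J : Ideal R)

lemma tr_comp {s t u : ℕ} (h : s ≤ t) (h' : t ≤ u) : tr J h' ≫ tr J h = tr J (h.trans h') := by
  apply ModuleCat.hom_ext
  apply LinearMap.ext
  intro x
  obtain ⟨x, rfl⟩ := Submodule.Quotient.mk_surjective _ x
  rfl

/-- restriction along the transition maps -/
def res {t t' : ℕ} (h : t ≤ t') {N : ModuleCat.{0} R} {i : ℕ}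
    (x : Ext (ModuleCat.of R (R ⧸ J ^ t)) N i) : Ext (ModuleCat.of R (R ⧸ J ^ t')) N i :=
  (Ext.mk₀ (tr J h)).comp x (zero_add _)

lemma V_def (i : ℕ) (N : ModuleCat.{0} R) : V J i N ↔
    ∀ (t : ℕ) (x : Ext (ModuleCat.of R (R ⧸ J ^ t)) N i), ∃ (t' : ℕ) (h : t ≤ t'),
      res J h x = 0 := Iff.rfl

lemma res_res {s t u : ℕ} (h : s ≤ t) (h' : t ≤ u) {N : ModuleCat.{0} R} {i : ℕ}
    (x : Ext (ModuleCat.of R (R ⧸ J ^ s)) N i) : res J h' (res J h x) = res J (h.trans h') x := by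
  rw [res, res, res, Ext.mk₀_comp_mk₀_assoc, tr_comp]

lemma res_comp {s t : ℕ} (h : s ≤ t) {N N' : ModuleCat.{0} R} {i j k : ℕ}
    (x : Ext (ModuleCat.of R (R ⧸ J ^ s)) N i) (y : Ext N N' j) (e : i + j = k) :
    res J h (x.comp y e) = (res J h x).comp y e := by
  rw [res, res, Ext.comp_assoc _ _ _ (zero_add _) e (by omega)]

lemma zero_comp' {X Y Z : ModuleCat.{0} R} {i j k : ℕ} (y : Ext Y Z j) (e : i + j = k) :
    (0 : Ext X Y i).comp y e = 0 := by simp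

lemma V_mid {S : ShortComplex (ModuleCat.{0} R)} (hS : S.ShortExact) {i : ℕ}
    (h1 : V J i S.X₁) (h3 : V J i S.X₃) : V J i S.X₂ := by
  intro t x
  obtain ⟨t1, ht1, e1⟩ := h3 t (x.comp (Ext.mk₀ S.g) (add_zero _))
  change res J ht1 _ = 0 at e1
  rw [res_comp] at e1
  obtain ⟨y, hy⟩ := Ext.covariant_sequence_exact₂ _ hS _ e1
  obtain ⟨t2, ht2, e2⟩ := h1 t1 y
  refine ⟨t2, ht1.trans ht2, ?_⟩
  change res J _ _ = 0
  change res J _ _ = 0 at e2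
  rw [← res_res J ht1 ht2, ← hy, res_comp, e2, zero_comp']

lemma V_right {S : ShortComplex (ModuleCat.{0} R)} (hS : S.ShortExact) {i : ℕ}
    (h2 : V J i S.X₂) (h1 : V J (i+1) S.X₁) : V J i S.X₃ := by
  intro t x
  obtain ⟨t1, ht1, e1⟩ := h1 t (x.comp hS.extClass rfl)
  change res J ht1 _ = 0 at e1
  rw [res_comp] at e1
  obtain ⟨y, hy⟩ := Ext.covariant_sequence_exact₃ _ hS _ rfl e1
  obtain ⟨t2, ht2, e2⟩ := h2 t1 y
  refine ⟨t2, ht1.trans ht2, ?_⟩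
  change res J _ _ = 0
  change res J _ _ = 0 at e2
  rw [← res_res J ht1 ht2, ← hy, res_comp, e2, zero_comp']

lemma V_left {S : ShortComplex (ModuleCat.{0} R)} (hS : S.ShortExact) {i : ℕ}
    (h3 : V J i S.X₃) (h2 : V J (i+1) S.X₂) : V J (i+1) S.X₁ := by
  intro t x
  obtain ⟨t1, ht1, e1⟩ := h2 t (x.comp (Ext.mk₀ S.f) (add_zero _))
  change res J ht1 _ = 0 at e1
  rw [res_comp] at e1
  obtain ⟨y, hy⟩ := Ext.covariant_sequence_exact₁ _ hS _ e1 rfl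
  obtain ⟨t2, ht2, e2⟩ := h3 t1 y
  refine ⟨t2, ht1.trans ht2, ?_⟩
  change res J _ _ = 0
  change res J _ _ = 0 at e2
  rw [← res_res J ht1 ht2, ← hy, res_comp, e2, zero_comp']

lemma V_iso {A B : ModuleCat.{0} R} (e : A ≅ B) {i : ℕ} (h : V J i A) : V J i B := by
  intro t x
  obtain ⟨t1, ht1, e1⟩ := h t (x.comp (Ext.mk₀ e.inv) (add_zero _))
  refine ⟨t1, ht1, ?_⟩
  change res J _ _ = 0
  change res J _ _ = 0 at e1
  rw [res_comp] at e1
  have : ((res J ht1 x).comp (Ext.mk₀ e.inv) (add_zero _)).comp (Ext.mk₀ e.hom) (add_zero _) = 0 := by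
    rw [e1, zero_comp']
  simpa using this

lemma V_inj {A : ModuleCat.{0} R} [Injective A] (i : ℕ) : V J (i+1) A :=
  fun t x => ⟨t, le_rfl, by rw [Ext.eq_zero_of_injective x, Ext.comp_zero]⟩

lemma V_zero_left {S : ShortComplex (ModuleCat.{0} R)} (hS : S.ShortExact)
    (h2 : V J 0 S.X₂) : V J 0 S.X₁ := by
  intro t x
  obtain ⟨t1, ht1, e1⟩ := h2 t (x.comp (Ext.mk₀ S.f) (add_zero _))
  refine ⟨t1, ht1, ?_⟩
  change res J ht1 _ = 0 at e1
  change res J ht1 _ = 0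
  rw [res_comp] at e1
  have := hS.mono_f
  exact Ext.postcomp_mk₀_injective_of_mono _ S.f (by simpa using e1)

/-- short exact sequences from linear maps -/
abbrev sc {A B C : Type} [AddCommGroup A] [AddCommGroup B] [AddCommGroup C]
    [Module R A] [Module R B] [Module R C] (f : A →ₗ[R] B) (g : B →ₗ[R] C)
    (h : Function.Exact f g) : ShortComplex (ModuleCat.{0} R) :=
  ShortComplex.mk (X₁ := ModuleCat.of R A) (X₂ := ModuleCat.of R B) (X₃ := ModuleCat.of R C)
    (ModuleCat.ofHom f) (ModuleCat.ofHom g) (by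
      apply ModuleCat.hom_ext
      exact h.linearMap_comp_eq_zero)

lemma sc_exact {A B C : Type} [AddCommGroup A] [AddCommGroup B] [AddCommGroup C]
    [Module R A] [Module R B] [Module R C] (f : A →ₗ[R] B) (g : B →ₗ[R] C)
    (h : Function.Exact f g) (hf : Function.Injective f) (hg : Function.Surjective g) :
    (sc f g h).ShortExact where
  exact := (ShortComplex.ShortExact.moduleCat_exact_iff_function_exact _).2 h
  mono_f := (ModuleCat.mono_iff_injective _).2 hf
  epi_g := (ModuleCat.epi_iff_surjective _).2 hg

variable {A B C : Type} [AddCommGroup A] [AddCommGroup B] [AddCommGroup C]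
    [Module R A] [Module R B] [Module R C]

lemma sub_exact (N : Submodule R A) : (sc N.subtype N.mkQ (LinearMap.exact_subtype_mkQ N)).ShortExact :=
  sc_exact _ _ _ N.subtype_injective N.mkQ_surjective

lemma inj_exact (f : A →ₗ[R] B) (hf : Function.Injective f) :
    (sc f (LinearMap.range f).mkQ (LinearMap.exact_map_mkQ_range f)).ShortExact :=
  sc_exact _ _ _ hf (Submodule.mkQ_surjective _)

end Vex
end GM



namespace GM
open Abelian
section C2
variable {R : Type} [CommRing R] (J : Ideal R)
variable {N : Type} [AddCommGroup N] [Module R N]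

lemma exists_mk₀ {X Y : ModuleCat.{0} R} (x : Ext X Y 0) : ∃ f : X ⟶ Y, Ext.mk₀ f = x :=
  (Ext.mk₀_bijective X Y).2 x

lemma mk₀_inj {X Y : ModuleCat.{0} R} {f g : X ⟶ Y} (h : Ext.mk₀ f = Ext.mk₀ g) : f = g :=
  (Ext.mk₀_bijective X Y).1 h

/-- the map `R/J^t → N` with `1 ↦ e` -/
def el {t : ℕ} (e : N) (he : ∀ r ∈ J ^ t, r • e = 0) :
    ModuleCat.of R (R ⧸ J ^ t) ⟶ ModuleCat.of R N :=
  ModuleCat.ofHom ((J ^ t).liftQ (LinearMap.toSpanSingleton R N e) (fun r hr => by simpa using he r hr))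

lemma el_one {t : ℕ} (e : N) (he : ∀ r ∈ J ^ t, r • e = 0) (r : R) :
    (el J e he).hom (Ideal.Quotient.mk (J ^ t) r) = r • e := rfl

lemma hom_eq {t : ℕ} (f g : ModuleCat.of R (R ⧸ J ^ t) ⟶ ModuleCat.of R N)
    (h : f.hom (Ideal.Quotient.mk (J ^ t) 1) = g.hom (Ideal.Quotient.mk (J ^ t) 1)) : f = g := by
  apply ModuleCat.hom_ext
  apply LinearMap.ext
  intro x
  obtain ⟨x, rfl⟩ := Ideal.Quotient.mk_surjective x
  have : (Ideal.Quotient.mk (J ^ t) x : R ⧸ J ^ t) = x • (Ideal.Quotient.mk (J ^ t) 1) := by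
    rw [← Ideal.Quotient.mk_eq_mk, ← Ideal.Quotient.mk_eq_mk, ← Submodule.Quotient.mk_smul]; simp
  rw [this, map_smul, map_smul, h]

lemma hom_kill {t : ℕ} (f : ModuleCat.of R (R ⧸ J ^ t) ⟶ ModuleCat.of R N) (r : R) (hr : r ∈ J ^ t) :
    r • f.hom (Ideal.Quotient.mk (J ^ t) 1) = 0 := by
  rw [← map_smul]
  have : r • (Ideal.Quotient.mk (J ^ t) 1 : R ⧸ J ^ t) = 0 := by
    rw [← Ideal.Quotient.mk_eq_mk, ← Submodule.Quotient.mk_smul, Submodule.Quotient.mk_eq_zero]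
    simpa using hr
  rw [this, map_zero]

lemma tr_one {s t : ℕ} (h : s ≤ t) : (tr J h).hom (Ideal.Quotient.mk (J ^ t) 1) =
    Ideal.Quotient.mk (J ^ s) 1 := rfl

lemma V_zero_iff : V J 0 (ModuleCat.of R N) ↔ Gam J N = ⊥ := by
  constructor
  · intro h
    rw [eq_bot_iff]
    rintro e ⟨k, hk⟩
    obtain ⟨t, ht, e1⟩ := h k (Ext.mk₀ (el J e hk))
    rw [Ext.mk₀_comp_mk₀, Ext.mk₀_eq_zero_iff] at e1
    have := congrArg (fun f => f.hom (Ideal.Quotient.mk (J ^ t) 1)) e1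
    change (1 : R) • e = 0 at this
    simpa using this
  · intro h t x
    obtain ⟨f, rfl⟩ := exists_mk₀ x
    refine ⟨t, le_rfl, ?_⟩
    have : f = 0 := by
      apply hom_eq
      have : f.hom (Ideal.Quotient.mk (J ^ t) 1) ∈ Gam J N := ⟨t, hom_kill J f⟩
      rw [h] at this
      simpa using this
    rw [this]; simp

lemma V_tors [IsNoetherianRing R] (i : ℕ) : ∀ (N : Type) [AddCommGroup N] [Module R N],
    Gam J N = ⊤ → V J (i+1) (ModuleCat.of R N) := by
  induction i with
  | zero =>
    intro N _ _ h t x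
    obtain ⟨E, _, _, f, hE, hf, hE'⟩ := exists_baer_tors J h
    have := injective_of_baer hE
    have hS := inj_exact f hf
    have : Injective (sc f (LinearMap.range f).mkQ (LinearMap.exact_map_mkQ_range f)).X₂ := this
    obtain ⟨y, hy⟩ := Ext.covariant_sequence_exact₁ _ hS x (Ext.eq_zero_of_injective _) (zero_add 1)
    obtain ⟨y, rfl⟩ := exists_mk₀ y
    obtain ⟨e, he⟩ := Submodule.mkQ_surjective _ (y.hom (Ideal.Quotient.mk (J ^ t) 1))
    have : e ∈ Gam J E := by rw [hE']; trivial
    obtain ⟨k, hk⟩ := this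
    have hk' : ∀ r ∈ J ^ (max t k), r • e = 0 := fun r hr => hk r (Ideal.pow_le_pow_right (le_max_right t k) hr)
    refine ⟨max t k, le_max_left _ _, ?_⟩
    have e1 : tr J (le_max_left t k) ≫ y = el J e hk' ≫
        (sc f (LinearMap.range f).mkQ (LinearMap.exact_map_mkQ_range f)).g := by
      apply hom_eq J (N := E ⧸ LinearMap.range f)
      change y.hom (Ideal.Quotient.mk (J ^ t) 1) = (LinearMap.range f).mkQ ((1 : R) • e)
      rw [one_smul]
      exact he.symm
    rw [← hy, Ext.mk₀_comp_mk₀_assoc, e1, ← Ext.mk₀_comp_mk₀_assoc, ShortComplex.ShortExact.comp_extClass,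
      Ext.comp_zero]
  | succ i ih =>
    intro N _ _ h
    obtain ⟨E, _, _, f, hE, hf, hE'⟩ := exists_baer_tors J h
    have := injective_of_baer hE
    have hS := inj_exact f hf
    refine V_left J hS (ih (E ⧸ LinearMap.range f) ?_) (V_inj (A := ModuleCat.of R E) J _)
    rw [eq_top_iff]
    intro x _
    obtain ⟨x, rfl⟩ := Submodule.mkQ_surjective _ x
    have : x ∈ Gam J E := by rw [hE']; trivial
    obtain ⟨k, hk⟩ := this
    exact ⟨k, fun r hr => by rw [← map_smul, hk r hr, map_zero]⟩

lemma gam_gam : Gam J (Gam J N) = ⊤ := by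
  rw [eq_top_iff]
  rintro ⟨x, k, hk⟩ _
  exact ⟨k, fun r hr => Subtype.ext (hk r hr)⟩

end C2
end GM



namespace GM
open Abelian
open scoped Pointwise
section C3
variable {R : Type} [CommRing R] (J : Ideal R)

lemma reg_exists [IsNoetherianRing R] {N : Type} [AddCommGroup N] [Module R N] [Module.Finite R N]
    (h : Gam J N = ⊥) : ∃ x ∈ J, IsSMulRegular N x := by
  by_contra hc
  push Not at hc
  obtain ⟨P, hP, h'⟩ : ∃ P ∈ associatedPrimes R N, J ≤ P :=
    (J.subset_union_prime_finite (associatedPrimes.finite ..) (f := id) 0 0 fun _ h _ _ ↦ h.1).1 (by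
      simp only [id]
      rw [biUnion_associatedPrimes_eq_compl_regular]
      exact fun x hx => hc x hx)
  rw [AssociatedPrimes.mem_iff, isAssociatedPrime_iff] at hP
  obtain ⟨prime, x, rfl⟩ := hP
  have : x ∈ Gam J N := ⟨1, fun r hr => by
    have := h' (by simpa using hr : r ∈ J)
    simpa [Submodule.mem_colon_singleton] using this⟩
  rw [h] at this
  have hx : x = 0 := by simpa using this
  apply prime.ne_top
  rw [hx]
  rw [Ideal.eq_top_iff_one]
  simp [Submodule.mem_colon_singleton]

lemma res_smul {s t : ℕ} (h : s ≤ t) {N : ModuleCat.{0} R} {i : ℕ} (r : R)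
    (x : Ext (ModuleCat.of R (R ⧸ J ^ s)) N i) : res J h (r • x) = r • res J h x := by
  rw [res, res, Ext.comp_smul]

lemma pow_smul_ext {t : ℕ} {N : ModuleCat.{0} R} {i : ℕ} (r : R) (hr : r ∈ J ^ t)
    (x : Ext (ModuleCat.of R (R ⧸ J ^ t)) N i) : r • x = 0 := by
  have : r • (𝟙 (ModuleCat.of R (R ⧸ J ^ t))) = 0 := by
    apply hom_eq
    exact hom_kill J (𝟙 (ModuleCat.of R (R ⧸ J ^ t))) r hr
  have h2 : (Ext.mk₀ (r • (𝟙 (ModuleCat.of R (R ⧸ J ^ t))))).comp x (zero_add i) = 0 := by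
    rw [this]; simp
  rw [Ext.mk₀_smul, Ext.smul_comp] at h2
  simpa using h2

lemma V_of_reg {N : Type} [AddCommGroup N] [Module R N] {i : ℕ} (x : R) (hx : x ∈ J) (hreg : IsSMulRegular N x)
    (h : V J i (ModuleCat.of R (QuotSMulTop x N))) : V J (i+1) (ModuleCat.of R N) := by
  have hex : Function.Exact (LinearMap.lsmul R N x) (x • (⊤ : Submodule R N)).mkQ := by
    exact LinearMap.exact_iff.2 (by rw [Submodule.ker_mkQ]; ext y; simp [Submodule.mem_smul_pointwise_iff_exists])
  have hS := sc_exact _ _ hex hreg (Submodule.mkQ_surjective _)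
  have key : ∀ (k t : ℕ) (ξ : Ext (ModuleCat.of R (R ⧸ J ^ t)) (ModuleCat.of R N) (i+1)), x ^ k • ξ = 0 →
      ∃ (t' : ℕ) (h : t ≤ t'), res J h ξ = 0 := by
    intro k
    induction k with
    | zero => intro t ξ hξ; exact ⟨t, le_rfl, by
                rw [pow_zero, one_smul] at hξ; rw [hξ, res, Ext.comp_zero]⟩
    | succ k ih =>
      intro t ξ hξ
      have h1 : (x ^ k • ξ).comp (Ext.mk₀ (sc _ _ hex).f) (add_zero _) = 0 := by
        have e0 : (sc _ _ hex).f = x • 𝟙 (ModuleCat.of R N) := rfl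
        rw [e0, Ext.mk₀_smul, Ext.comp_smul]
        simp only [Ext.comp_mk₀_id]
        rw [smul_smul, ← pow_succ', hξ]
      obtain ⟨η, hη⟩ := Ext.covariant_sequence_exact₁ _ hS _ h1 rfl
      obtain ⟨t1, ht1, e1⟩ := h t η
      change res J _ _ = 0 at e1
      have h2 : x ^ k • res J ht1 ξ = 0 := by
        rw [← res_smul, ← hη, res_comp, e1, zero_comp']
      obtain ⟨t2, ht2, e2⟩ := ih t1 _ h2
      exact ⟨t2, ht1.trans ht2, by rw [← res_res J ht1 ht2, e2]⟩
  intro t ξ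
  exact key t t ξ (pow_smul_ext J _ (Ideal.pow_mem_pow hx t) ξ)

lemma V_of_gam [IsNoetherianRing R] {N : Type} [AddCommGroup N] [Module R N] {i : ℕ}
    (h : V J (i+1) (ModuleCat.of R (N ⧸ Gam J N))) : V J (i+1) (ModuleCat.of R N) :=
  V_mid J (sub_exact (Gam J N)) (V_tors J i _ (gam_gam J)) h

lemma V_gam [IsNoetherianRing R] {N : Type} [AddCommGroup N] [Module R N] {i : ℕ}
    (h : V J (i) (ModuleCat.of R N)) : V J (i) (ModuleCat.of R (N ⧸ Gam J N)) :=
  V_right J (sub_exact (Gam J N)) h (V_tors J _ _ (gam_gam J))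

theorem V_dim [IsNoetherianRing R] (d : ℕ) : ∀ (N : Type) [AddCommGroup N] [Module R N]
    [Module.Finite R N], Module.supportDim R N < d → ∀ i, d ≤ i → V J i (ModuleCat.of R N) := by
  induction d with
  | zero =>
    intro N _ _ _ h i _
    have : Subsingleton N := by
      rw [← Module.supportDim_eq_bot_iff_subsingleton (R := R)]
      by_contra hne
      obtain ⟨a, ha⟩ := WithBot.ne_bot_iff_exists.1 hne
      rw [← ha] at h
      have : (0 : WithBot ℕ∞) ≤ a := by exact_mod_cast zero_le
      exact absurd h (by simp)
    have hz : Limits.IsZero (ModuleCat.of R N) := ModuleCat.isZero_of_subsingleton _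
    intro t x
    refine ⟨t, le_rfl, ?_⟩
    have hx : x = 0 := by
      have h1 : 𝟙 (ModuleCat.of R N) = 0 := hz.eq_of_src _ _
      have h2 := Ext.comp_mk₀_id x
      rw [h1, Ext.mk₀_zero, Ext.comp_zero] at h2
      exact h2.symm
    rw [hx, Ext.comp_zero]
  | succ d ih =>
    intro N _ _ _ h i hi
    obtain ⟨i, rfl⟩ : ∃ j, i = j + 1 := ⟨i - 1, by omega⟩
    apply V_of_gam
    obtain ⟨x, hx, hreg⟩ := reg_exists J (gam_quot_eq_bot (N := N) J)
    apply V_of_reg J x hx hreg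
    apply ih _ _ i (by omega)
    have h1 := Module.supportDim_le_of_surjective (R := R) (Gam J N).mkQ (Submodule.mkQ_surjective _)
    have h2 := Module.supportDim_quotSMulTop_succ_le_of_notMem_minimalPrimes (R := R)
      (M := N ⧸ Gam J N) (fun _ => hreg.notMem_of_mem_minimalPrimes)
    have h3 := (h2.trans h1).trans_lt h
    push_cast at h3
    exact lt_of_add_lt_add_right h3

end C3
end GM



namespace GM
open Abelian
section D1
variable {R : Type} [CommRing R] (J : Ideal R)

lemma exists_map {M : Type} [AddCommGroup M] [Module R M] [Module.Finite R M]
    (q : PrimeSpectrum R) (hq : q ∈ Module.support R M) :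
    ∃ f : M →ₗ[R] (R ⧸ q.asIdeal), f ≠ 0 := by
  classical
  rw [Module.mem_support_iff_nontrivial_residueField_tensorProduct] at hq
  let κ := q.asIdeal.ResidueField
  obtain ⟨v, hv⟩ := exists_ne (0 : TensorProduct R κ M)
  obtain ⟨φ, hφ⟩ : ∃ φ : Module.Dual κ (TensorProduct R κ M), φ v ≠ 0 := by
    by_contra hc
    push Not at hc
    exact hv ((Module.forall_dual_apply_eq_zero_iff κ v).1 hc)
  let g : M →ₗ[R] κ := (φ.restrictScalars R) ∘ₗ (TensorProduct.mk R κ M 1)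
  have hg : ∃ m, g m ≠ 0 := by
    by_contra hc
    push Not at hc
    apply hφ
    induction v using TensorProduct.induction_on with
    | zero => simp
    | tmul a b =>
      have : (a ⊗ₜ[R] b : TensorProduct R κ M) = a • ((1 : κ) ⊗ₜ[R] b) := by
        rw [TensorProduct.smul_tmul']; simp
      rw [this, map_smul]
      have h2 : φ ((1 : κ) ⊗ₜ[R] b) = 0 := hc b
      rw [h2, smul_zero]
    | add a b ha hb =>
      rw [map_add]
      by_cases h1 : φ a = 0
      · by_cases h2 : φ b = 0
        · rw [h1, h2, add_zero]
        · exact absurd (hb (by rintro rfl; simp at h2) h2) h2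
      · exact absurd (ha (by rintro rfl; simp at h1) h1) h1
  obtain ⟨m0, hm0⟩ := hg
  obtain ⟨s, hs⟩ := Module.Finite.fg_top (R := R) (M := M)
  obtain ⟨b, hb⟩ := IsLocalization.exist_integer_multiples_of_finset
    (nonZeroDivisors (R ⧸ q.asIdeal)) (s.image g)
  obtain ⟨c, hc⟩ := Ideal.Quotient.mk_surjective (b : R ⧸ q.asIdeal)
  let ι : (R ⧸ q.asIdeal) →ₗ[R] κ := (IsScalarTower.toAlgHom R (R ⧸ q.asIdeal) κ).toLinearMap
  have hι : Function.Injective ι := IsFractionRing.injective (R ⧸ q.asIdeal) κ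
  have hcb : ∀ y : κ, c • y = (b : R ⧸ q.asIdeal) • y := by
    intro y
    rw [← hc, Algebra.smul_def, Algebra.smul_def]; rfl
  have hr : ∀ m, (c • g) m ∈ LinearMap.range ι := by
    intro m
    have hm : m ∈ Submodule.span R (s : Set M) := by rw [hs]; trivial
    have : Submodule.span R (s : Set M) ≤ (LinearMap.range ι).comap (c • g) := by
      rw [Submodule.span_le]
      intro x hx
      obtain ⟨y, hy⟩ := hb (g x) (Finset.mem_image_of_mem _ hx)
      refine ⟨y, ?_⟩
      rw [LinearMap.smul_apply, hcb]
      exact hy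
    exact this hm
  let e := LinearEquiv.ofInjective ι hι
  refine ⟨e.symm.toLinearMap ∘ₗ LinearMap.codRestrict (LinearMap.range ι) (c • g) hr, fun h0 => ?_⟩
  have h1 := LinearMap.congr_fun h0 m0
  simp only [LinearMap.comp_apply, LinearEquiv.coe_coe, LinearMap.zero_apply,
    LinearEquiv.map_eq_zero_iff] at h1
  have h2 : c • g m0 = 0 := congrArg Subtype.val h1
  rw [hcb, Algebra.smul_def, mul_eq_zero] at h2
  rcases h2 with h2 | h2
  · exact nonZeroDivisors.coe_ne_zero b ((map_eq_zero_iff _ hι).1 h2)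
  · exact hm0 h2

lemma V_sub {N : Type} [AddCommGroup N] [Module R N] [Subsingleton N] (i : ℕ) :
    V J i (ModuleCat.of R N) := by
  have hz : Limits.IsZero (ModuleCat.of R N) := ModuleCat.isZero_of_subsingleton _
  intro t x
  refine ⟨t, le_rfl, ?_⟩
  have hx : x = 0 := by
    have h1 : 𝟙 (ModuleCat.of R N) = 0 := hz.eq_of_src _ _
    have h2 := Ext.comp_mk₀_id x
    rw [h1, Ext.mk₀_zero, Ext.comp_zero] at h2
    exact h2.symm
  rw [hx, Ext.comp_zero]

lemma V_equiv {N N' : Type} [AddCommGroup N] [Module R N] [AddCommGroup N'] [Module R N']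
    (e : N ≃ₗ[R] N') {i : ℕ} (h : V J i (ModuleCat.of R N)) : V J i (ModuleCat.of R N') :=
  V_iso J e.toModuleIso h

lemma V_filt [IsNoetherianRing R] (i : ℕ) (Z : Set (PrimeSpectrum R))
    (hZ : ∀ p ∈ Z, V J i (ModuleCat.of R (R ⧸ p.asIdeal)))
    (N : Type) [AddCommGroup N] [Module R N] [hN : Module.Finite R N]
    (h : Module.support R N ⊆ Z) : V J i (ModuleCat.of R N) := by
  induction hN using IsNoetherianRing.induction_on_isQuotientEquivQuotientPrime R with
  | subsingleton N => exact V_sub J i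
  | quotient N p e =>
    apply V_equiv J e.symm
    apply hZ
    apply h
    rw [LinearEquiv.support_eq e]
    rw [Module.support_eq_zeroLocus]
    simp [Ideal.annihilator_quotient]
  | exact N₁ N₂ N₃ f g hf hg hfg h₁ h₃ =>
    have := Module.support_of_exact hfg hf hg
    rw [this] at h
    exact V_mid J (sc_exact f g hfg hf hg) (h₁ (Set.subset_union_left.trans h))
      (h₃ (Set.subset_union_right.trans h))

theorem V_supp [IsNoetherianRing R] (B : ℕ)
    (hB : ∀ (N : Type) [AddCommGroup N] [Module R N] [Module.Finite R N], ∀ i, B ≤ i →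
      V J i (ModuleCat.of R N))
    (M : Type) [AddCommGroup M] [Module R M] [Module.Finite R M] (c : ℕ)
    (hM : ∀ i, c < i → V J i (ModuleCat.of R M)) (k : ℕ) :
    ∀ i, c < i → B ≤ i + k → ∀ (N : Type) [AddCommGroup N] [Module R N] [Module.Finite R N],
      Module.support R N ⊆ Module.support R M → V J i (ModuleCat.of R N) := by
  induction k with
  | zero => intro i _ hi N _ _ _ _; exact hB N i (by omega)
  | succ k ih =>
    intro i hc hi N _ _ _ hN
    apply V_filt J i (Module.support R M) _ N hN
    intro p
    have hwf : WellFounded ((· > ·) : Ideal R → Ideal R → Prop) := wellFounded_gt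
    obtain ⟨p, hp⟩ := p
    induction p using hwf.induction with
    | _ q ihq =>
    intro hqM
    obtain ⟨f, hf⟩ := exists_map (M := M) ⟨q, hp⟩ hqM
    change M →ₗ[R] R ⧸ q at f
    -- image of f
    have hrange : V J i (ModuleCat.of R (LinearMap.range f)) := by
      have hex : Function.Exact (LinearMap.ker f).subtype f.rangeRestrict := by
        rw [LinearMap.exact_iff]; simp
      refine V_right J (sc_exact _ _ hex (Submodule.subtype_injective _) f.surjective_rangeRestrict)
        (hM i hc) ?_
      exact ih (i+1) (by omega) (by omega) (LinearMap.ker f)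
        (Module.support_subset_of_injective _ (Submodule.subtype_injective _))
    refine V_mid J (sub_exact (LinearMap.range f)) hrange ?_
    refine V_filt J i {p : PrimeSpectrum R | q < p.asIdeal ∧ p ∈ Module.support R M} ?_
      ((R ⧸ q) ⧸ LinearMap.range f) ?_
    · intro p' hp'
      exact ihq p'.asIdeal hp'.1 p'.2 hp'.2
    · intro p' hp'
      have h1 : q ≤ p'.asIdeal := by
        have := Module.support_subset_of_surjective _ (Submodule.mkQ_surjective (LinearMap.range f)) hp'
        rw [Module.support_eq_zeroLocus] at this
        simpa [Ideal.annihilator_quotient] using this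
      have h2 : ∃ a, a ∉ q ∧ a ∈ p'.asIdeal := by
        have : ∃ m, f m ≠ 0 := by
          by_contra hcc
          push Not at hcc
          exact hf (LinearMap.ext hcc)
        obtain ⟨m, hm⟩ := this
        obtain ⟨a, ha⟩ := Ideal.Quotient.mk_surjective (f m)
        refine ⟨a, fun h => hm (by rw [← ha]; exact Ideal.Quotient.eq_zero_iff_mem.2 h), ?_⟩
        rw [Module.support_eq_zeroLocus] at hp'
        apply hp'
        rw [SetLike.mem_coe, Module.mem_annihilator]
        intro x
        obtain ⟨x, rfl⟩ := Submodule.mkQ_surjective _ x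
        obtain ⟨x, rfl⟩ := Ideal.Quotient.mk_surjective x
        rw [← map_smul, Submodule.mkQ_apply, Submodule.Quotient.mk_eq_zero]
        refine ⟨x • m, ?_⟩
        rw [map_smul, ← ha, Algebra.smul_def, Algebra.smul_def, mul_comm]; rfl
      obtain ⟨a, ha, ha'⟩ := h2
      refine ⟨lt_of_le_of_ne h1 (by rintro rfl; exact ha ha'), ?_⟩
      exact Module.mem_support_mono (M := M) (p := ⟨q, hp⟩) (q := p') h1 hqM

end D1
end GM



namespace GM
open Abelian
section E1
variable {T : Type} [CommRing T]

/-- a `T`-linear map commuting with `X` is `T[X]`-linear -/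
def mkLin {A B : Type} [AddCommGroup A] [AddCommGroup B] [Module T A] [Module T B]
    [Module (Polynomial T) A] [Module (Polynomial T) B] [IsScalarTower T (Polynomial T) A]
    [IsScalarTower T (Polynomial T) B] (f : A →ₗ[T] B)
    (hf : ∀ a, f ((Polynomial.X : Polynomial T) • a) = (Polynomial.X : Polynomial T) • f a) :
    A →ₗ[Polynomial T] B where
  toFun := f
  map_add' := f.map_add
  map_smul' := by
    intro p
    simp only [RingHom.id_apply]
    induction p using Polynomial.induction_on with
    | C t =>
      intro a
      have h1 : (Polynomial.C t) • a = t • a := by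
        rw [← Polynomial.algebraMap_eq, algebraMap_smul]
      have h2 : (Polynomial.C t) • f a = t • f a := by
        rw [← Polynomial.algebraMap_eq, algebraMap_smul]
      rw [h1, h2, map_smul]
    | add p q hp hq => intro a; rw [add_smul, map_add, hp, hq, add_smul]
    | monomial n t h =>
      intro a
      rw [pow_succ, ← mul_assoc, mul_smul, h, hf, mul_smul _ Polynomial.X]

/-- the shift -/
def shift (T W : Type) [CommRing T] [AddCommGroup W] [Module T W] : (ℕ → W) →ₗ[T] (ℕ → W) where
  toFun a k := a (k+1)
  map_add' _ _ := rfl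
  map_smul' _ _ := rfl

/-- the coinduced module `Hom_T(T[X], W)` -/
abbrev Co (T W : Type) [CommRing T] [AddCommGroup W] [Module T W] : Type := Module.AEval' (shift T W)

variable {W : Type} [AddCommGroup W] [Module T W]

/-- coordinates -/
def cv : Co T W ≃ₗ[T] (ℕ → W) := (Module.AEval.of T (ℕ → W) (shift T W)).symm

lemma cv_X (a : Co T W) (k : ℕ) :
    cv ((Polynomial.X : Polynomial T) • a) k = cv a (k+1) := by
  have := Module.AEval.of_symm_X_smul (R := T) (shift T W) a
  exact congrFun this k

lemma cv_ext {a b : Co T W} (h : ∀ k, cv a k = cv b k) : a = b :=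
  cv.injective (funext h)

/-- functoriality -/
def Co.map {W' : Type} [AddCommGroup W'] [Module T W'] (f : W →ₗ[T] W') :
    Co T W →ₗ[Polynomial T] Co T W' :=
  mkLin (cv.symm.toLinearMap ∘ₗ (LinearMap.compLeft f ℕ) ∘ₗ cv.toLinearMap) (by
    intro a
    apply cv_ext
    intro k
    rw [cv_X]
    simp [cv_X])

lemma Co.map_cv {W' : Type} [AddCommGroup W'] [Module T W'] (f : W →ₗ[T] W') (a : Co T W) (k : ℕ) :
    cv (Co.map f a) k = f (cv a k) := by
  change cv (cv.symm _) k = _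
  simp

/-- adjunction -/
def Co.lift {A : Type} [AddCommGroup A] [Module T A]
    [Module (Polynomial T) A] [IsScalarTower T (Polynomial T) A] (h : A →ₗ[T] W) :
    A →ₗ[Polynomial T] Co T W :=
  mkLin (cv.symm.toLinearMap ∘ₗ
    { toFun := fun a k => h ((Polynomial.X ^ k : Polynomial T) • a)
      map_add' := fun a b => by ext k; simp
      map_smul' := fun t a => by
        ext k
        simp only [RingHom.id_apply, Pi.smul_apply]
        rw [← map_smul, smul_comm] }) (by
    intro a
    apply cv_ext
    intro k
    rw [cv_X]
    simp [smul_smul, pow_succ])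

lemma Co.lift_cv {A : Type} [AddCommGroup A] [Module T A]
    [Module (Polynomial T) A] [IsScalarTower T (Polynomial T) A] (h : A →ₗ[T] W) (a : A) (k : ℕ) :
    cv (Co.lift h a) k = h ((Polynomial.X ^ k : Polynomial T) • a) := by
  change cv (cv.symm _) k = _
  simp

lemma cv_Xpow (a : Co T W) (k : ℕ) :
    cv ((Polynomial.X ^ k : Polynomial T) • a) 0 = cv a k := by
  have : ∀ j, cv ((Polynomial.X ^ k : Polynomial T) • a) j = cv a (j + k) := by
    induction k with
    | zero => intro j; simp
    | succ k ih => intro j; rw [pow_succ', mul_smul, cv_X, ih, add_right_comm, add_assoc]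
  simpa using this 0

lemma Co.injective (hW : Module.Injective T W) : Module.Injective (Polynomial T) (Co T W) := by
  constructor
  intro A B _ _ _ _ f hf g
  let : Module T A := Module.compHom A (Polynomial.C : T →+* Polynomial T)
  let : Module T B := Module.compHom B (Polynomial.C : T →+* Polynomial T)
  have : IsScalarTower T (Polynomial T) A := ⟨fun t p a => by
    rw [Polynomial.smul_eq_C_mul, mul_smul]; rfl⟩
  have : IsScalarTower T (Polynomial T) B := ⟨fun t p a => by
    rw [Polynomial.smul_eq_C_mul, mul_smul]; rfl⟩
  obtain ⟨h, hh⟩ := hW.out (f.restrictScalars T) hf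
    (LinearMap.proj 0 ∘ₗ cv.toLinearMap ∘ₗ g.restrictScalars T)
  refine ⟨Co.lift h, fun x => ?_⟩
  apply cv_ext
  intro k
  rw [Co.lift_cv, ← map_smul, ← cv_Xpow, ← map_smul]
  exact hh _

lemma Co.injdim (n : ℕ) : ∀ (W : Type) [AddCommGroup W] [Module T W],
    HasInjectiveDimensionLT (ModuleCat.of T W) (n+1) →
    HasInjectiveDimensionLT (ModuleCat.of (Polynomial T) (Co T W)) (n+1) := by
  induction n with
  | zero =>
    intro W _ _ h
    simp only [zero_add] at h ⊢
    rw [← injective_iff_hasInjectiveDimensionLT_one, ← Module.injective_iff_injective_object] at h ⊢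
    exact Co.injective h
  | succ n ih =>
    intro W _ _ h
    obtain ⟨E, _, _, f, hE, hf⟩ := exists_baer (R := T) W
    have hi := injective_of_baer hE
    have h3 := ((inj_exact f hf).hasInjectiveDimensionLT_X₃_iff n hi).2 h
    have hC : Injective (ModuleCat.of (Polynomial T) (Co T E)) := by
      rw [← Module.injective_iff_injective_object]
      exact Co.injective (Module.Baer.injective hE)
    have hex : Function.Exact (Co.map f) (Co.map (LinearMap.range f).mkQ) := by
      intro y
      constructor
      · intro hy
        have : ∀ k, ∃ w, f w = cv y k := by
          intro k
          have h2 := Co.map_cv (LinearMap.range f).mkQ y k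
          rw [hy] at h2
          simpa using h2.symm
        choose w hw using this
        refine ⟨cv.symm w, cv_ext fun k => ?_⟩
        rw [Co.map_cv, ← hw]; simp
      · rintro ⟨x, rfl⟩
        apply cv_ext
        intro k
        rw [Co.map_cv, Co.map_cv]; simp
    refine ((sc_exact _ _ hex ?_ ?_).hasInjectiveDimensionLT_X₃_iff n hC).1 (ih _ h3)
    · intro a b hab
      apply cv_ext
      intro k
      apply hf
      rw [← Co.map_cv, ← Co.map_cv, hab]
    · intro y
      choose w hw using fun k => Submodule.mkQ_surjective (LinearMap.range f) (cv y k)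
      refine ⟨cv.symm w, cv_ext fun k => ?_⟩
      rw [Co.map_cv, ← hw]; simp

lemma gl_poly (d : ℕ) (h : ∀ (W : Type) [AddCommGroup W] [Module T W],
    HasInjectiveDimensionLT (ModuleCat.of T W) (d+1)) (Z : Type) [AddCommGroup Z]
    [Module (Polynomial T) Z] : HasInjectiveDimensionLT (ModuleCat.of (Polynomial T) Z) (d+2) := by
  let : Module T Z := Module.compHom Z (Polynomial.C : T →+* Polynomial T)
  have : IsScalarTower T (Polynomial T) Z := ⟨fun t p a => by
    rw [Polynomial.smul_eq_C_mul, mul_smul]; rfl⟩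
  have hc := Co.injdim d Z (h Z)
  let X' : Polynomial T := Polynomial.X
  let mX : Z →ₗ[T] Z := (LinearMap.lsmul (Polynomial T) Z X').restrictScalars T
  have hmX : ∀ z, mX z = X' • z := fun z => rfl
  let f : Z →ₗ[Polynomial T] Co T Z := Co.lift LinearMap.id
  let g : Co T Z →ₗ[Polynomial T] Co T Z := LinearMap.lsmul (Polynomial T) _ X' - Co.map mX
  have hg : ∀ a k, cv (g a) k = cv a (k+1) - X' • cv a k := by
    intro a k
    change cv (X' • a - Co.map mX a) k = _
    rw [map_sub, Pi.sub_apply, cv_X, Co.map_cv, hmX]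
  have hff : ∀ z k, cv (f z) k = X' ^ k • z := by
    intro z k
    rw [Co.lift_cv]; rfl
  have hex : Function.Exact f g := by
    intro y
    constructor
    · intro hy
      refine ⟨cv y 0, cv_ext fun k => ?_⟩
      rw [hff]
      induction k with
      | zero => simp
      | succ k ih =>
        have := hg y k
        rw [hy, map_zero, Pi.zero_apply] at this
        rw [sub_eq_zero.1 this.symm, pow_succ', mul_smul, ih]
    · rintro ⟨z, rfl⟩
      apply cv_ext
      intro k
      rw [hg, hff, hff, pow_succ', mul_smul]; simp
  refine (sc_exact f g hex ?_ ?_).hasInjectiveDimensionLT_X₁ (d+1) hc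
    (hasInjectiveDimensionLT_of_ge (ModuleCat.of (Polynomial T) (Co T Z)) (d+1) (d+1+1) (by omega))
  · intro a b hab
    have := congrArg (fun y => cv y 0) hab
    simpa [hff] using this
  · intro y
    let w : ℕ → Z := fun k => Nat.rec 0 (fun k z => cv y k + X' • z) k
    refine ⟨cv.symm w, cv_ext fun k => ?_⟩
    rw [hg, LinearEquiv.apply_symm_apply]
    change (cv y k + X' • w k) - X' • w k = _
    simp

/-- every module has injective dimension `≤ d` -/
def GlDim (T : Type) [CommRing T] (d : ℕ) : Prop := ∀ (W : Type) [AddCommGroup W] [Module T W],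
    HasInjectiveDimensionLT (ModuleCat.of T W) (d+1)

lemma GlDim.equiv {T' : Type} [CommRing T'] (e : T ≃+* T') {d : ℕ} (h : GlDim T d) : GlDim T' d := by
  intro W _ _
  let : Module T W := Module.compHom W e.toRingHom
  have h1 := h W
  have hp1 := RingHomInvPair.of_ringEquiv e
  have hp2 := RingHomInvPair.of_ringEquiv e.symm
  let eI : ModuleCat.of T W ≃ₛₗ[RingHomClass.toRingHom e] ModuleCat.of T' W := {
      __ := AddEquiv.refl W
      map_smul' r i := rfl }
  exact (ModuleCat.hasInjectiveDimensionLE_iff_of_semiLinearEquiv e eI d).1 h1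

lemma GlDim.field (K : Type) [Field K] : GlDim K 0 := by
  intro W _ _
  simp only [zero_add]
  rw [← injective_iff_hasInjectiveDimensionLT_one, ← Module.injective_iff_injective_object]
  constructor
  intro A B _ _ _ _ f hf g
  obtain ⟨r, hr⟩ := LinearMap.exists_leftInverse_of_injective f (LinearMap.ker_eq_bot.2 hf)
  refine ⟨g ∘ₗ r, fun x => ?_⟩
  have := LinearMap.congr_fun hr x
  simp only [LinearMap.comp_apply, LinearMap.id_apply] at this ⊢
  rw [this]

lemma GlDim.fin (K : Type) [Field K] (n : ℕ) : GlDim (MvPolynomial (Fin n) K) n := by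
  induction n with
  | zero => exact (GlDim.field K).equiv (MvPolynomial.isEmptyRingEquiv K (Fin 0)).symm
  | succ n ih =>
    exact GlDim.equiv (MvPolynomial.finSuccEquiv K n).symm.toRingEquiv (fun Z _ _ => gl_poly n ih Z)

lemma GlDim.mv (K : Type) [Field K] (m n : ℕ) : GlDim (MvPolynomial (Fin m ⊕ Fin n) K) (m+n) :=
  (GlDim.fin K (m+n)).equiv (MvPolynomial.renameEquiv K finSumFinEquiv).symm.toRingEquiv

end E1
end GM



namespace GM
open Abelian
section F1
variable {R : Type} [CommRing R] (J : Ideal R)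

lemma hom_tors_zero {A N : Type} [AddCommGroup A] [Module R A] [AddCommGroup N] [Module R N]
    (hA : Gam J A = ⊤) (hN : Gam J N = ⊥) (x : Ext (ModuleCat.of R A) (ModuleCat.of R N) 0) :
    x = 0 := by
  obtain ⟨f, rfl⟩ := exists_mk₀ x
  have : f = 0 := by
    apply ModuleCat.hom_ext
    apply LinearMap.ext
    intro a
    have : a ∈ Gam J A := by rw [hA]; trivial
    obtain ⟨k, hk⟩ := this
    have h2 : f.hom a ∈ Gam J N := ⟨k, fun r hr => by rw [← map_smul, hk r hr, map_zero]⟩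
    rw [hN] at h2
    simpa using h2
  rw [this, Ext.mk₀_zero]

lemma gam_quotJ : Gam J (R ⧸ J) = ⊤ := by
  rw [eq_top_iff]
  intro x _
  obtain ⟨x, rfl⟩ := Ideal.Quotient.mk_surjective x
  refine ⟨1, fun r hr => ?_⟩
  rw [pow_one] at hr
  rw [Algebra.smul_def]
  exact (Ideal.Quotient.eq_zero_iff_mem (I := J)).2 (J.mul_mem_right x hr)

/-- minimal annihilating power -/
lemma exists_killed {N : Type} [AddCommGroup N] [Module R N] (h : Gam J N ≠ ⊥) :
    ∃ e : N, e ≠ 0 ∧ ∀ r ∈ J, r • e = 0 := by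
  classical
  obtain ⟨e, he, hne⟩ := Submodule.exists_mem_ne_zero_of_ne_bot h
  have hex : ∃ k : ℕ, ∀ r ∈ J ^ k, r • e = 0 := he
  have hmin := fun {k} => Nat.find_min hex (m := k)
  have hk := Nat.find_spec hex
  rcases hk0 : Nat.find hex with _ | k
  · rw [hk0] at hk
    exact absurd (by simpa using hk 1 (by simp)) hne
  · have := hmin (k := k) (by omega)
    push Not at this
    obtain ⟨r, hr, hre⟩ := this
    refine ⟨r • e, hre, fun s hs => ?_⟩
    rw [smul_smul]
    apply hk
    rw [hk0, pow_succ']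
    exact Ideal.mul_mem_mul hs hr

lemma gam_of_hom {N : Type} [AddCommGroup N] [Module R N]
    (h : ∀ x : Ext (ModuleCat.of R (R ⧸ J)) (ModuleCat.of R N) 0, x = 0) : Gam J N = ⊥ := by
  by_contra hne
  obtain ⟨e, hne, he⟩ := exists_killed J hne
  let f : ModuleCat.of R (R ⧸ J) ⟶ ModuleCat.of R N :=
    ModuleCat.ofHom (Submodule.liftQ J (LinearMap.toSpanSingleton R N e)
      (fun r hr => by simpa using he r hr))
  have h1 := h (Ext.mk₀ f)
  rw [Ext.mk₀_eq_zero_iff] at h1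
  have h2 := congrArg (fun f => f.hom (Ideal.Quotient.mk J 1)) h1
  change (1 : R) • e = 0 at h2
  exact hne (by simpa using h2)

theorem ext_tors [IsNoetherianRing R] (g : ℕ) : ∀ (M : Type) [AddCommGroup M] [Module R M],
    (∀ j, j < g → ∀ x : Ext (ModuleCat.of R (R ⧸ J)) (ModuleCat.of R M) j, x = 0) →
    ∀ (A : Type) [AddCommGroup A] [Module R A], Gam J A = ⊤ →
    ∀ j, j < g → ∀ x : Ext (ModuleCat.of R A) (ModuleCat.of R M) j, x = 0 := by
  induction g with
  | zero => intro M _ _ _ A _ _ _ j hj; omega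
  | succ g ih =>
    intro M _ _ h A _ _ hA j hj x
    have hM : Gam J M = ⊥ := gam_of_hom J (h 0 (by omega))
    obtain ⟨E, _, _, f, hE, hf, hE'⟩ := exists_baer_free J hM
    have hi := injective_of_baer hE
    have hS := inj_exact f hf
    have hM' : ∀ j, j < g → ∀ x : Ext (ModuleCat.of R (R ⧸ J))
        (ModuleCat.of R (E ⧸ LinearMap.range f)) j, x = 0 := by
      intro j hj x
      obtain ⟨y, hy⟩ := Ext.covariant_sequence_exact₃ _ hS x rfl (h (j+1) (by omega) _)
      have hy0 : y = 0 := by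
        rcases j with _ | j
        · exact hom_tors_zero J (gam_quotJ J) hE' y
        · exact Ext.eq_zero_of_injective (I := ModuleCat.of R E) y
      rw [← hy, hy0, Ext.zero_comp]
    rcases j with _ | j
    · exact hom_tors_zero J hA hM x
    · obtain ⟨y, hy⟩ := Ext.covariant_sequence_exact₁ _ hS x
        (Ext.eq_zero_of_injective (I := ModuleCat.of R E) _) rfl
      rw [← hy, ih (E ⧸ LinearMap.range f) hM' A hA j (by omega) y, Ext.zero_comp]

lemma ext_sub {A T : Type} [AddCommGroup A] [Module R A] [AddCommGroup T] [Module R T]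
    (h : ∀ a : A, a = 0) {i : ℕ} (x : Ext (ModuleCat.of R A) (ModuleCat.of R T) i) : x = 0 := by
  have h1 : 𝟙 (ModuleCat.of R A) = 0 := by
    apply ModuleCat.hom_ext
    apply LinearMap.ext
    intro a
    rw [h a]; simp
  have h2 := Ext.mk₀_id_comp x
  rw [h1, Ext.mk₀_zero, Ext.zero_comp] at h2
  exact h2.symm

lemma ext_bij {A T : Type} [AddCommGroup A] [Module R A] [AddCommGroup T] [Module R T]
    (r : R) (hA : Function.Bijective (LinearMap.lsmul R A r)) (hT : ∀ z : T, r • z = 0) {i : ℕ}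
    (x : Ext (ModuleCat.of R A) (ModuleCat.of R T) i) : x = 0 := by
  have h0 : r • x = 0 := by
    have h1 : r • 𝟙 (ModuleCat.of R T) = 0 := by
      apply ModuleCat.hom_ext
      apply LinearMap.ext
      intro a
      exact hT a
    have h2 := Ext.smul_eq_comp_mk₀ x r
    rw [h1, Ext.mk₀_zero, Ext.comp_zero] at h2
    exact h2
  let e := LinearEquiv.ofBijective _ hA
  have h3 : (Ext.mk₀ (r • 𝟙 (ModuleCat.of R A))).comp x (zero_add i) = 0 := by
    rw [Ext.mk₀_smul, Ext.smul_comp, Ext.mk₀_id_comp, h0]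
  have h4 : ModuleCat.ofHom e.symm.toLinearMap ≫ (r • 𝟙 (ModuleCat.of R A)) =
      𝟙 (ModuleCat.of R A) := by
    apply ModuleCat.hom_ext
    apply LinearMap.ext
    intro a
    exact e.apply_symm_apply a
  have h5 := Ext.mk₀_id_comp x
  rw [← h4, ← Ext.mk₀_comp_mk₀_assoc, h3, Ext.comp_zero] at h5
  exact h5.symm

theorem ext_free_aux [IsDomain R] [IsNoetherianRing R] {T : Type} [AddCommGroup T] [Module R T] (t : ℕ)
    (l : List R) : (∀ y ∈ l, y ≠ 0) → (∀ y ∈ l, ∀ z : T, y ^ t • z = 0) →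
    ∀ (E : Type) [AddCommGroup E] [Module R E], Module.Baer R E →
    (∀ e : E, (∀ y ∈ l, y • e = 0) → e = 0) →
    ∀ (i : ℕ) (x : Ext (ModuleCat.of R E) (ModuleCat.of R T) i), x = 0 := by
  classical
  induction l with
  | nil =>
    intro _ _ E _ _ _ h i x
    exact ext_sub (fun a => h a (by simp)) x
  | cons y l ih =>
    intro h0 hT E _ _ hE h i x
    have h1 := ih (fun z hz => h0 z (by simp [hz])) (fun z hz => hT z (by simp [hz]))
      (Gam (Ideal.span {y}) E) (gam_baer _ hE) (by
        intro e he
        by_contra hne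
        obtain ⟨e, k, hk⟩ := e
        have hne' : e ≠ 0 := fun h => hne (Subtype.ext h)
        have hl : ∀ z ∈ l, z • e = 0 := fun z hz => congrArg Subtype.val (he z hz)
        have : ∀ j, y ^ j • e ≠ 0 := by
          intro j
          induction j with
          | zero => simpa using hne'
          | succ j ihj =>
            intro hj
            apply ihj
            apply h
            intro z hz
            rcases List.mem_cons.1 hz with rfl | hz
            · rw [smul_smul, ← pow_succ', hj]
            · rw [smul_comm, hl z hz, smul_zero]
        exact this k (hk _ (Ideal.pow_mem_pow (Ideal.mem_span_singleton_self y) k)))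
    obtain ⟨x', hx'⟩ := Ext.contravariant_sequence_exact₂ (sub_exact (Gam (Ideal.span {y}) E))
      (ModuleCat.of R T) x (h1 _ _)
    have hbij : Function.Bijective (LinearMap.lsmul R (E ⧸ Gam (Ideal.span {y}) E) y) := by
      constructor
      · rw [injective_iff_map_eq_zero]
        intro a ha
        have : a ∈ Gam (Ideal.span {y}) (E ⧸ Gam (Ideal.span {y}) E) := ⟨1, fun r hr => by
          rw [pow_one] at hr
          obtain ⟨s, rfl⟩ := Ideal.mem_span_singleton'.1 hr
          rw [mul_smul]
          change s • (LinearMap.lsmul R (E ⧸ Gam (Ideal.span {y}) E) y) a = 0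
          rw [ha, smul_zero]⟩
        rw [gam_quot_eq_bot] at this
        simpa using this
      · intro a
        obtain ⟨a, rfl⟩ := Submodule.mkQ_surjective _ a
        obtain ⟨u, hu⟩ := (Module.Baer.injective hE).out (LinearMap.lsmul R R y)
          (fun a b hab => mul_left_cancel₀ (h0 y (by simp)) hab) (LinearMap.toSpanSingleton R E a)
        refine ⟨Submodule.mkQ _ (u 1), ?_⟩
        rw [LinearMap.lsmul_apply, ← map_smul, ← map_smul]
        congr 1
        simpa using hu 1
    have hpow : ∀ k, Function.Bijective (LinearMap.lsmul R (E ⧸ Gam (Ideal.span {y}) E) (y ^ k)) := by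
      intro k
      induction k with
      | zero =>
        have h1 : (LinearMap.lsmul R (E ⧸ Gam (Ideal.span {y}) E) (y ^ 0) : _ → _) = id := by
          funext a
          rw [LinearMap.lsmul_apply, pow_zero, one_smul, id]
        rw [h1]
        exact Function.bijective_id
      | succ k ihk =>
        have h1 : (LinearMap.lsmul R (E ⧸ Gam (Ideal.span {y}) E) (y ^ (k+1)) : _ → _)
            = (LinearMap.lsmul R (E ⧸ Gam (Ideal.span {y}) E) y : _ → _) ∘
              (LinearMap.lsmul R (E ⧸ Gam (Ideal.span {y}) E) (y ^ k) : _ → _) := by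
          funext a
          rw [Function.comp_apply, LinearMap.lsmul_apply, LinearMap.lsmul_apply,
            LinearMap.lsmul_apply, pow_succ', mul_smul]
        rw [h1]
        exact hbij.comp ihk
    rw [← hx', ext_bij (y ^ t) (hpow t) (hT y (by simp)) x', Ext.comp_zero]

theorem ext_free [IsDomain R] [IsNoetherianRing R] (l : List R) (hl : ∀ y ∈ l, y ≠ 0)
    (hJ : J = Ideal.span {y | y ∈ l}) {T : Type} [AddCommGroup T] [Module R T] (t : ℕ)
    (hT : ∀ r ∈ J ^ t, ∀ z : T, r • z = 0) (E : Type) [AddCommGroup E] [Module R E]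
    (hE : Module.Baer R E) (hE' : Gam J E = ⊥) (i : ℕ)
    (x : Ext (ModuleCat.of R E) (ModuleCat.of R T) i) : x = 0 := by
  refine ext_free_aux t l hl (fun y hy z => hT _ (Ideal.pow_mem_pow ?_ t) z) E hE ?_ i x
  · rw [hJ]; exact Ideal.subset_span hy
  · intro e he
    have : e ∈ Gam J E := ⟨1, fun r hr => by
      rw [pow_one, hJ] at hr
      induction hr using Submodule.span_induction with
      | mem y hy => exact he y hy
      | zero => simp
      | add a b _ _ ha hb => rw [add_smul, ha, hb, add_zero]
      | smul a b _ hb => rw [smul_eq_mul, mul_smul, hb, smul_zero]⟩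
    rw [hE'] at this
    simpa using this

theorem key_claim [IsDomain R] [IsNoetherianRing R] (l : List R) (hl : ∀ y ∈ l, y ≠ 0)
    (hJ : J = Ideal.span {y | y ∈ l}) (d : ℕ) (hd : GlDim R d) (g : ℕ)
    {M T : Type} [AddCommGroup M] [Module R M] [AddCommGroup T] [Module R T] (t : ℕ)
    (hT : ∀ r ∈ J ^ t, ∀ z : T, r • z = 0)
    (hM : ∀ j, j < g → ∀ x : Ext (ModuleCat.of R (R ⧸ J)) (ModuleCat.of R M) j, x = 0)
    (φ : ModuleCat.of R M ⟶ ModuleCat.of R T) (s : ℕ) :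
    ∀ k, d + 1 ≤ k + s → ∀ (N : Type) [AddCommGroup N] [Module R N],
      (∀ i, g ≤ i + k → V J i (ModuleCat.of R N)) →
      ∀ x : Ext (ModuleCat.of R N) (ModuleCat.of R M) k, x.comp (Ext.mk₀ φ) (add_zero k) = 0 := by
  induction s with
  | zero =>
    intro k hk N _ _ _ x
    have := hd M
    rw [Ext.eq_zero_of_hasInjectiveDimensionLT x (d+1) (by omega), Ext.zero_comp]
  | succ s ih =>
    intro k hk N _ _ hV x
    have h1 : (Ext.mk₀ (sc (Gam J N).subtype (Gam J N).mkQ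
        (LinearMap.exact_subtype_mkQ _)).f).comp x (zero_add _) = 0 := by
      by_cases hkg : k < g
      · exact ext_tors J g M hM (Gam J N) (gam_gam J) k hkg _
      · have := (V_zero_iff J).1 (hV 0 (by omega))
        refine ext_sub (A := Gam J N) (fun a => ?_) _
        have ha : (a : N) ∈ (⊥ : Submodule R N) := this.le a.2
        exact Subtype.ext (by simpa using ha)
    obtain ⟨xb, rfl⟩ := Ext.contravariant_sequence_exact₂ (sub_exact (Gam J N)) _ x h1
    rw [Ext.comp_assoc_of_third_deg_zero]
    suffices hs : xb.comp (Ext.mk₀ φ) (add_zero k) = 0 by rw [hs, Ext.comp_zero]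
    obtain ⟨E, _, _, f, hE, hf, hE'⟩ := exists_baer_free J (gam_quot_eq_bot (N := N) J)
    have hi := injective_of_baer hE
    have hS := inj_exact f hf
    have hV' : ∀ i, g ≤ i + (k+1) → V J i (ModuleCat.of R (E ⧸ LinearMap.range f)) := by
      intro i hi'
      refine V_right J hS ?_ (V_gam J (hV (i+1) (by omega)))
      rcases i with _ | i
      · exact (V_zero_iff J).2 hE'
      · exact V_inj (A := ModuleCat.of R E) J i
    have h2 := ih (k+1) (by omega) (E ⧸ LinearMap.range f) hV' (hS.extClass.comp xb (add_comm 1 k))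
    rw [Ext.comp_assoc_of_third_deg_zero] at h2
    obtain ⟨z, hz⟩ := Ext.contravariant_sequence_exact₁ hS _ _ (add_comm 1 k) h2
    rw [← hz, ext_free J l hl hJ t hT E hE hE' k z, Ext.comp_zero]

end F1
end GM



namespace GM
section G1
variable {K : Type} [Field K] {m n : ℕ} {M : Type} [AddCommGroup M] [Module (BGS K m n) M]
  {ℳ : ℕ × ℕ → AddSubgroup M}

/-- generated in `Q`-degree at least `t` -/
def Fil (ℳ : ℕ × ℕ → AddSubgroup M) (t : ℕ) : AddSubgroup M :=
  AddSubgroup.closure {z | ∃ d : ℕ × ℕ, t ≤ d.2 ∧ z ∈ ℳ d}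

lemma fil_smul (hM : IsBigrading K m n M ℳ) (t : ℕ) (s : BGS K m n) (z : M) (hz : z ∈ Fil ℳ t) :
    s • z ∈ Fil ℳ t := by
  induction hz using AddSubgroup.closure_induction with
  | zero => rw [smul_zero]; exact zero_mem _
  | add a b _ _ ha hb => rw [smul_add]; exact add_mem ha hb
  | neg a _ ha => rw [smul_neg]; exact neg_mem ha
  | mem z hz =>
    obtain ⟨d, hd, hz⟩ := hz
    induction s using MvPolynomial.induction_on' with
    | monomial u a =>
      refine AddSubgroup.subset_closure ⟨Finsupp.weight (bwt m n) u + d, ?_,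
        hM.smul_mem _ _ _ _ (isWeightedHomogeneous_monomial (bwt m n) u a rfl) hz⟩
      exact hd.trans (by simp)
    | add p q hp hq => rw [add_smul]; exact add_mem hp hq

lemma fil_X (hM : IsBigrading K m n M ℳ) (t : ℕ) (j : Fin n) (z : M) (hz : z ∈ Fil ℳ t) :
    (X (Sum.inr j) : BGS K m n) • z ∈ Fil ℳ (t+1) := by
  induction hz using AddSubgroup.closure_induction with
  | zero => rw [smul_zero]; exact zero_mem _
  | add a b _ _ ha hb => rw [smul_add]; exact add_mem ha hb
  | neg a _ ha => rw [smul_neg]; exact neg_mem ha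
  | mem z hz =>
    obtain ⟨d, hd, hz⟩ := hz
    refine AddSubgroup.subset_closure ⟨_, ?_,
      hM.smul_mem _ _ _ _ (isWeightedHomogeneous_X K (bwt m n) (Sum.inr j)) hz⟩
    simp [bwt]
    omega

lemma fil_pow (hM : IsBigrading K m n M ℳ) (t : ℕ) (z : M)
    (hz : z ∈ (idealQ K m n ^ t • (⊤ : Submodule (BGS K m n) M))) : z ∈ Fil ℳ t := by
  induction t generalizing z with
  | zero =>
    obtain ⟨w, rfl⟩ := hM.internal.2 z
    induction w using DirectSum.induction_on with
    | zero => rw [map_zero]; exact zero_mem _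
    | of d y =>
      rw [DirectSum.coeAddMonoidHom_of]
      exact AddSubgroup.subset_closure ⟨d, Nat.zero_le _, y.2⟩
    | add a b ha hb =>
      rw [map_add]
      exact add_mem (ha (by rw [pow_zero, Ideal.one_eq_top, Submodule.top_smul]; trivial))
        (hb (by rw [pow_zero, Ideal.one_eq_top, Submodule.top_smul]; trivial))
  | succ t ih =>
    rw [pow_succ', Submodule.mul_smul] at hz
    induction hz using Submodule.smul_induction_on' with
    | add a _ b _ ha hb => exact add_mem ha hb
    | smul r hr y hy =>
      have hy := ih y hy
      rw [idealQ] at hr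
      induction hr using Submodule.span_induction with
      | mem r hr => obtain ⟨j, rfl⟩ := hr; exact fil_X hM t j y hy
      | zero => rw [zero_smul]; exact zero_mem _
      | add a b _ _ ha hb => rw [add_smul]; exact add_mem ha hb
      | smul a b _ hb => rw [smul_eq_mul, mul_smul]; exact fil_smul hM _ _ _ hb

lemma sep (hM : IsBigrading K m n M ℳ) (z : M)
    (hz : ∀ t, z ∈ (idealQ K m n ^ t • (⊤ : Submodule (BGS K m n) M))) : z = 0 := by
  classical
  let _ := hM.internal.chooseDecomposition
  have key : ∀ t z, z ∈ Fil ℳ t → ∀ d : ℕ × ℕ, d.2 < t → (DirectSum.decompose ℳ z d : M) = 0 := by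
    intro t z hz d hd
    induction hz using AddSubgroup.closure_induction with
    | zero => simp
    | add a b _ _ ha hb => simp [ha, hb]
    | neg a _ ha =>
      rw [DirectSum.decompose_neg]
      change -(DirectSum.decompose ℳ a d : M) = 0
      rw [ha, neg_zero]
    | mem z hz =>
      obtain ⟨e, he, hz⟩ := hz
      exact DirectSum.decompose_of_mem_ne ℳ hz (by rintro rfl; omega)
  apply (DirectSum.decompose ℳ).injective
  rw [DirectSum.decompose_zero]
  ext d
  simpa using key (d.2+1) z (fil_pow hM _ z (hz _)) d (by omega)

end G1

section G2
variable {R : Type} [CommRing R] (J : Ideal R) (M : Type) [AddCommGroup M] [Module R M]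

lemma cohDim_le (c : ℕ) (h : ∀ i, c < i → V J i (ModuleCat.of R M)) : cohDim R J M ≤ c := by
  refine csSup_le' fun i hi => ?_
  by_contra hc
  exact (lc_nontrivial_iff J i _).1 hi (h i (by omega))

lemma le_cohDim (B : ℕ) (hB : ∀ i, B ≤ i → V J i (ModuleCat.of R M)) (i : ℕ)
    (h : ¬ V J i (ModuleCat.of R M)) : i ≤ cohDim R J M := by
  refine le_csSup ⟨B, fun i hi => ?_⟩ ((lc_nontrivial_iff J i _).2 h)
  by_contra hc
  exact (lc_nontrivial_iff J i _).1 hi (hB i (by omega))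

lemma ext_lt (j : ℕ) (hj : j < extGrade R J M)
    (x : Abelian.Ext (ModuleCat.of R (R ⧸ J)) (ModuleCat.of R M) j) : x = 0 := by
  by_contra hx
  exact Nat.notMem_of_lt_sInf hj ((nontrivial_ext_iff _ _ _).2 ⟨x, hx⟩)

lemma cohDim_dim [IsNoetherianRing R] [Module.Finite R M] [Nontrivial M] :
    (cohDim R J M : WithBot ℕ∞) ≤ Module.supportDim R M := by
  have h0 : (0 : WithBot ℕ∞) ≤ Module.supportDim R M := by
    rw [Module.supportDim]
    have : Nonempty (Module.support R M) := (Module.nonempty_support_of_nontrivial).to_subtype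
    exact Order.krullDim_nonneg
  by_contra hc
  rw [not_le] at hc
  have hV := V_dim J (cohDim R J M) M hc
  have hle := cohDim_le J M (cohDim R J M - 1) (fun i hi => hV i (by omega))
  have : cohDim R J M = 0 := by omega
  rw [this] at hc
  exact absurd hc (not_lt.2 h0)

lemma cohDim_ass [IsNoetherianRing R] [Module.Finite R M] (B : ℕ)
    (hB : ∀ (N : Type) [AddCommGroup N] [Module R N] [Module.Finite R N], ∀ i, B ≤ i →
      V J i (ModuleCat.of R N)) (p : Ideal R) (hp : p ∈ associatedPrimes R M) :
    cohDim R J (R ⧸ p) ≤ cohDim R J M := by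
  obtain ⟨_, f, hf⟩ := (isAssociatedPrime_iff_exists_injective_linearMap _ _).1 hp
  refine cohDim_le J _ _ fun i hi => ?_
  refine V_supp J B hB M (cohDim R J M) (fun i hi => ?_) B i hi (by omega) (R ⧸ p)
    (Module.support_subset_of_injective f hf)
  by_contra hv
  exact absurd (le_cohDim J M B (hB M) i hv) (by omega)

lemma grade_zero [IsNoetherianRing R]
    (h : extGrade R J M = 0) (hne : {i : ℕ | Nontrivial
    (((Ext R (ModuleCat R) i).obj (Opposite.op (ModuleCat.of R (R ⧸ J)))).obj
      (ModuleCat.of R M))}.Nonempty) : mCohDim R J M = 0 := by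
  have h0 := Nat.sInf_mem hne
  change Nontrivial (((Ext R (ModuleCat R) (extGrade R J M)).obj _).obj _) at h0
  rw [h] at h0
  obtain ⟨x, hx⟩ := (nontrivial_ext_iff _ _ _).1 h0
  have hg : Gam J M ≠ ⊥ := by
    intro hg
    apply hx
    obtain ⟨f, rfl⟩ := exists_mk₀ x
    have : f = 0 := by
      refine ModuleCat.hom_ext (LinearMap.ext fun a => ?_)
      change f.hom a = 0
      have hm : f.hom a ∈ Gam J M := by
        have : a ∈ Gam J (R ⧸ J) := by rw [gam_quotJ]; trivial
        obtain ⟨k, hk⟩ := this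
        exact ⟨k, fun r hr => by rw [← map_smul, hk r hr, map_zero]⟩
      rw [hg] at hm
      simpa using hm
    rw [this, Abelian.Ext.mk₀_zero]
  obtain ⟨e, he0, he⟩ := exists_killed J hg
  obtain ⟨p, hp, hep⟩ := exists_le_isAssociatedPrime_of_isNoetherianRing R e he0
  have hJp : J ≤ p := fun r hr => hep (by simpa using he r hr)
  refine Nat.le_zero.1 ((Nat.sInf_le (Set.mem_image_of_mem _ hp)).trans ?_)
  refine cohDim_le J _ 0 fun i hi => ?_
  obtain ⟨i, rfl⟩ := Nat.exists_eq_succ_of_ne_zero hi.ne'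
  refine V_tors J i _ ?_
  rw [eq_top_iff]
  rintro a -
  refine ⟨1, fun r hr => ?_⟩
  rw [pow_one] at hr
  obtain ⟨a, rfl⟩ := Ideal.Quotient.mk_surjective a
  change Ideal.Quotient.mk p (r * a) = 0
  exact Ideal.Quotient.eq_zero_iff_mem.2 (p.mul_mem_right _ (hJp hr))

lemma step10 [IsDomain R] [IsNoetherianRing R] (l : List R) (hl : ∀ y ∈ l, y ≠ 0)
    (hJ : J = Ideal.span {y | y ∈ l}) (d : ℕ) (hd : GlDim R d) (g : ℕ)
    (hM : ∀ j, j < g → ∀ x : Abelian.Ext (ModuleCat.of R (R ⧸ J)) (ModuleCat.of R M) j, x = 0)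
    (hsep : ∀ z : M, (∀ t, z ∈ J ^ t • (⊤ : Submodule R M)) → z = 0)
    (p : Ideal R) (hp : p ∈ associatedPrimes R M) :
    ∃ i, g ≤ i ∧ ¬ V J i (ModuleCat.of R (R ⧸ p)) := by
  by_contra hcon
  push Not at hcon
  obtain ⟨hpp, f, hf⟩ := (isAssociatedPrime_iff_exists_injective_linearMap _ _).1 hp
  have hz : f (Ideal.Quotient.mk p 1) = 0 := by
    refine hsep _ fun t => ?_
    have := key_claim J l hl hJ d hd g (T := M ⧸ (J ^ t • (⊤ : Submodule R M))) t
      (fun r hr z => by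
        obtain ⟨z, rfl⟩ := Submodule.mkQ_surjective _ z
        rw [← map_smul, Submodule.mkQ_apply, Submodule.Quotient.mk_eq_zero]
        exact Submodule.smul_mem_smul hr trivial) hM
      (ModuleCat.ofHom (Submodule.mkQ _)) (d+1) 0 (by omega) (R ⧸ p)
      (fun i hi => hcon i (by omega)) (Abelian.Ext.mk₀ (ModuleCat.ofHom f))
    rw [Abelian.Ext.mk₀_comp_mk₀, ← Abelian.Ext.mk₀_zero] at this
    have h1 := mk₀_inj this
    have h2 := congrArg (fun u => u.hom (Ideal.Quotient.mk p 1)) h1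
    change Submodule.mkQ _ (f (Ideal.Quotient.mk p 1)) = 0 at h2
    rwa [Submodule.mkQ_apply, Submodule.Quotient.mk_eq_zero] at h2
  have : Ideal.Quotient.mk p 1 = 0 := hf (by rw [hz, map_zero])
  rw [Ideal.Quotient.eq_zero_iff_mem] at this
  exact hpp.ne_top ((Ideal.eq_top_iff_one p).2 this)

end G2
end GM

theorem grade_le_mgrade_le_cohDim_le_dim
    (K : Type) [Field K] [Infinite K] (m n : ℕ)
    (M : Type) [AddCommGroup M] [Module (BGS K m n) M] [Module.Finite (BGS K m n) M]
    [Nontrivial M]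
    (ℳ : ℕ × ℕ → AddSubgroup M) (hM : IsBigrading K m n M ℳ) :
    extGrade (BGS K m n) (idealQ K m n) M ≤ mCohDim (BGS K m n) (idealQ K m n) M ∧
    mCohDim (BGS K m n) (idealQ K m n) M ≤ cohDim (BGS K m n) (idealQ K m n) M ∧
    ((cohDim (BGS K m n) (idealQ K m n) M : WithBot ℕ∞)
      ≤ ringKrullDim (BGS K m n ⧸ (⊤ : Submodule (BGS K m n) M).annihilator)) ∧
    (extGrade (BGS K m n) (idealQ K m n) M = 0 ↔ mCohDim (BGS K m n) (idealQ K m n) M = 0) ∧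
    (mCohDim (BGS K m n) (idealQ K m n) M = 1 → extGrade (BGS K m n) (idealQ K m n) M = 1) := by
  have hB : ∀ (N : Type) [AddCommGroup N] [Module (BGS K m n) N] [Module.Finite (BGS K m n) N],
      ∀ i, m + n + 1 ≤ i → GM.V (idealQ K m n) i (ModuleCat.of (BGS K m n) N) := by
    intro N _ _ _ i hi
    refine GM.V_dim (idealQ K m n) (m + n + 1) N ?_ i hi
    refine lt_of_le_of_lt (Module.supportDim_le_ringKrullDim _ _) ?_
    rw [MvPolynomial.ringKrullDim_of_isNoetherianRing, ringKrullDim_eq_zero_of_field, zero_add,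
      Nat.card_sum, Nat.card_fin, Nat.card_fin]
    exact_mod_cast Nat.lt_succ_self _
  obtain ⟨p₀, hp₀⟩ := associatedPrimes.nonempty (BGS K m n) M
  let l : List (BGS K m n) := (List.finRange n).map fun j => X (Sum.inr j)
  have hstep := fun g hg p hp => GM.step10 (idealQ K m n) M l
    (by
      intro y hy
      obtain ⟨j, -, rfl⟩ := List.mem_map.1 hy
      exact MvPolynomial.X_ne_zero _)
    (by
      rw [idealQ]
      congr 1
      ext y
      simp [l]) (m + n) (GM.GlDim.mv K m n) g hg (GM.sep hM) p hp
  have hne : {i : ℕ | Nontrivial (((Ext (BGS K m n) (ModuleCat (BGS K m n)) i).obj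
      (Opposite.op (ModuleCat.of (BGS K m n) (BGS K m n ⧸ idealQ K m n)))).obj
      (ModuleCat.of (BGS K m n) M))}.Nonempty := by
    by_contra hcon
    rw [Set.not_nonempty_iff_eq_empty] at hcon
    obtain ⟨i, hi, hv⟩ := hstep (m + n + 1) (fun j _ x => by
      by_contra hx
      have := (GM.nontrivial_ext_iff _ _ _).2 ⟨x, hx⟩
      exact Set.eq_empty_iff_forall_notMem.1 hcon j this) p₀ hp₀
    exact hv (hB _ i hi)
  have hle : extGrade (BGS K m n) (idealQ K m n) M ≤ mCohDim (BGS K m n) (idealQ K m n) M := by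
    refine le_csInf ⟨_, p₀, hp₀, rfl⟩ ?_
    rintro _ ⟨p, hp, rfl⟩
    obtain ⟨i, hi, hv⟩ := hstep _ (GM.ext_lt (idealQ K m n) M) p hp
    exact hi.trans (GM.le_cohDim _ _ (m + n + 1) (hB _) i hv)
  have hz := fun h => GM.grade_zero (idealQ K m n) M h hne
  refine ⟨hle, ?_, ?_, ⟨hz, fun h => by omega⟩, fun h => ?_⟩
  · exact (Nat.sInf_le (Set.mem_image_of_mem _ hp₀)).trans (GM.cohDim_ass _ _ (m + n + 1) hB p₀ hp₀)
  · rw [Submodule.annihilator_top, ← Module.supportDim_eq_ringKrullDim_quotient_annihilator]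
    exact GM.cohDim_dim _ _
  · have : extGrade (BGS K m n) (idealQ K m n) M ≠ 0 := fun h' => by
      have := hz h'
      omega
    omega
end
end
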